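/- arXiv:2410.08366 — 5 statements merged into one kernel-verified Lean document; each statement's English description precedes it below -/
import Mathlib

section
/- Let n ≥ 1 and 1 ≤ a < n, and let R_h = ℤ[x_1,…,x_n,y_1,…,y_n]/I_h be the presentation of H^*(Hess(S,h)) for h = (a,n,…,n). Fix an exponent vector (ℓ_1,…,ℓ_{n−1}) with 0 ≤ ℓ_j ≤ n−1−j for all j and with ℓ_{n−j+1} = 0 for at least one j with a+1 ≤ j ≤ n. Then the n images in R_h of the elements x_n^{ℓ_1}x_{n−1}^{ℓ_2}⋯x_2^{ℓ_{n−1}}·y_k, for 1 ≤ k ≤ n, are ℤ-linearly independent. -/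
/-!
STATEMENT 13: In R_h = ℤ[x,y]/I_h (presentation of H^*(Hess(S,h)) for
h = (a,n,…,n), 1 ≤ a < n), for any fixed exponent vector (ℓ_1,…,ℓ_{n-1}) with
0 ≤ ℓ_j ≤ n-1-j and ℓ_{n-j+1} = 0 for some a+1 ≤ j ≤ n, the n images of
x_n^{ℓ_1}x_{n-1}^{ℓ_2}⋯x_2^{ℓ_{n-1}}·y_k (1 ≤ k ≤ n) are ℤ-linearly
independent.
-/

open MvPolynomial

namespace Stmt13

noncomputable def xv (n : ℕ) (j : Fin n) : MvPolynomial (Fin n ⊕ Fin n) ℤ :=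
  X (Sum.inl j)

noncomputable def yv (n : ℕ) (k : Fin n) : MvPolynomial (Fin n ⊕ Fin n) ℤ :=
  X (Sum.inr k)

noncomputable def Ih (n a : ℕ) (hn : 0 < n) : Ideal (MvPolynomial (Fin n ⊕ Fin n) ℤ) :=
  Ideal.span
    {p | (∃ k k' : Fin n, k ≠ k' ∧ p = yv n k * yv n k') ∨
         (∃ k : Fin n, p = xv n ⟨0, hn⟩ * yv n k) ∨
         (∃ k : Fin n, p =
            (∏ ℓ ∈ Finset.univ.filter (fun ℓ : Fin n => a ≤ (ℓ : ℕ)), (-xv n ℓ)) * yv n k -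
              ∏ ℓ ∈ Finset.univ.filter (fun ℓ : Fin n => 1 ≤ (ℓ : ℕ)), (-xv n ℓ)) ∨
         (p = (∑ k : Fin n, yv n k) -
            ∏ ℓ ∈ Finset.univ.filter (fun ℓ : Fin n => 1 ≤ (ℓ : ℕ) ∧ (ℓ : ℕ) < a),
              (xv n ⟨0, hn⟩ - xv n ℓ)) ∨
         (∃ i : ℕ, 1 ≤ i ∧ i ≤ n ∧ p = rename Sum.inl (esymm (Fin n) ℤ i))}

/-- The monomial x_n^{ℓ_1}x_{n-1}^{ℓ_2}⋯x_2^{ℓ_{n-1}} (ℓ is 0-indexed, so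
ℓ j is the 1-based exponent ℓ_{j+1}, multiplying x_{n-j} (1-based)). -/
noncomputable def mono (n : ℕ) (hn : 0 < n) (ℓ : Fin (n - 1) → ℕ) :
    MvPolynomial (Fin n ⊕ Fin n) ℤ :=
  ∏ j : Fin (n - 1), xv n ⟨n - 1 - (j : ℕ), by have := j.isLt; omega⟩ ^ ℓ j

noncomputable def alt (n : ℕ) : MvPolynomial (Fin n) ℤ →ₗ[ℤ] MvPolynomial (Fin n) ℤ :=
  ∑ σ : Equiv.Perm (Fin n), (Equiv.Perm.sign σ : ℤ) • (rename σ : MvPolynomial (Fin n) ℤ →ₐ[ℤ] _).toLinearMap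

lemma alt_apply (n : ℕ) (p : MvPolynomial (Fin n) ℤ) :
    alt n p = ∑ σ : Equiv.Perm (Fin n), (Equiv.Perm.sign σ : ℤ) • rename σ p := by
  simp [alt, LinearMap.sum_apply]

lemma alt_mul_symm (n : ℕ) (p q : MvPolynomial (Fin n) ℤ) (hq : q.IsSymmetric) :
    alt n (p * q) = alt n p * q := by
  rw [alt_apply, alt_apply, Finset.sum_mul]
  refine Finset.sum_congr rfl fun σ _ => ?_
  rw [map_mul, hq σ, smul_mul_assoc]

lemma rename_alt (n : ℕ) (p : MvPolynomial (Fin n) ℤ) (τ : Equiv.Perm (Fin n)) :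
    rename τ (alt n p) = (Equiv.Perm.sign τ : ℤ) • alt n p := by
  rw [alt_apply, map_sum, Finset.smul_sum]
  rw [← Equiv.sum_comp (Equiv.mulLeft τ)
    (fun σ : Equiv.Perm (Fin n) => (Equiv.Perm.sign τ : ℤ) • (Equiv.Perm.sign σ : ℤ) • rename σ p)]
  refine Finset.sum_congr rfl fun σ _ => ?_
  rw [map_zsmul, rename_rename, smul_smul]
  simp only [Equiv.coe_mulLeft, map_mul, Equiv.Perm.coe_mul, Units.val_mul]
  rw [← mul_assoc, ← Units.val_mul, Int.units_mul_self]
  simp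

lemma coeff_alt_eq_zero (n : ℕ) (p : MvPolynomial (Fin n) ℤ) (γ : Fin n →₀ ℕ) (s t : Fin n)
    (hst : s ≠ t) (h : γ s = γ t) : coeff γ (alt n p) = 0 := by
  have h1 := rename_alt n p (Equiv.swap s t)
  have h2 : Finsupp.mapDomain (Equiv.swap s t) γ = γ := by
    ext i
    rw [← Finsupp.equivMapDomain_eq_mapDomain, Finsupp.equivMapDomain_apply, Equiv.symm_swap]
    by_cases h3 : i = s
    · subst h3; simp [h]
    · by_cases h4 : i = t
      · subst h4; simp [h]
      · rw [Equiv.swap_apply_of_ne_of_ne h3 h4]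
  have h3 := coeff_rename_mapDomain (Equiv.swap s t) (Equiv.injective _) (alt n p) γ
  rw [h2, h1, Equiv.Perm.sign_swap hst] at h3
  simp at h3
  omega

noncomputable def delta (n : ℕ) : Fin n →₀ ℕ := Finsupp.equivFunOnFinite.symm (fun i => (i : ℕ))

lemma coeff_alt_esymm (n : ℕ) (p : MvPolynomial (Fin n) ℤ) (i : ℕ) (hi : 1 ≤ i) :
    coeff (delta n) (alt n (p * esymm (Fin n) ℤ i)) = 0 := by
  rw [alt_mul_symm _ _ _ (esymm_isSymmetric _ _ _), esymm_eq_sum_monomial, Finset.mul_sum, coeff_sum]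
  refine Finset.sum_eq_zero fun S hS => ?_
  rw [Finset.mem_powersetCard] at hS
  rw [coeff_mul_monomial']
  split_ifs with hle
  · rw [mul_one]
    have hne : S.Nonempty := by
      rw [← Finset.card_pos]; omega
    have hval : ∀ j, (∑ i ∈ S, Finsupp.single i 1 : Fin n →₀ ℕ) j = if j ∈ S then 1 else 0 := by
      intro j
      rw [Finsupp.finsetSum_apply]
      simp [Finsupp.single_apply]
    obtain ⟨s, hs, hmin⟩ := S.exists_min_image id hne
    have h0 := hle s
    rw [hval, if_pos hs] at h0
    have hs0 : 1 ≤ (s : ℕ) := h0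
    have ht : (⟨s - 1, by omega⟩ : Fin n) ∉ S := by
      intro hm
      have := hmin _ hm
      simp only [id, Fin.le_def] at this
      omega
    apply coeff_alt_eq_zero n p _ s ⟨s - 1, by omega⟩
    · intro h
      have := congrArg Fin.val h
      simp only at this
      omega
    · rw [Finsupp.tsub_apply, Finsupp.tsub_apply, hval, hval, if_pos hs, if_neg ht]
      simp [delta]
  · rfl

noncomputable def J (n : ℕ) : Ideal (MvPolynomial (Fin n) ℤ) :=
  Ideal.span {p | ∃ i : ℕ, 1 ≤ i ∧ i ≤ n ∧ p = esymm (Fin n) ℤ i}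

lemma coeff_alt_of_mem (n : ℕ) (p : MvPolynomial (Fin n) ℤ) (hp : p ∈ J n) :
    coeff (delta n) (alt n p) = 0 := by
  suffices h : ∀ q, coeff (delta n) (alt n (q * p)) = 0 by
    simpa using h 1
  unfold J at hp
  refine Submodule.span_induction (p := fun p _ => ∀ q, coeff (delta n) (alt n (q * p)) = 0)
    ?_ ?_ ?_ ?_ hp
  · rintro x ⟨i, hi, _, rfl⟩ q
    exact coeff_alt_esymm n q i hi
  · intro q
    simp
  · intro x y _ _ hx hy q
    rw [mul_add, map_add, coeff_add, hx, hy, add_zero]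
  · intro b x _ hx q
    rw [smul_eq_mul, ← mul_assoc]
    exact hx _

lemma coeff_alt_monomial (n : ℕ) (γ : Fin n → ℕ) (hγ : Function.Injective γ) (hlt : ∀ i, γ i < n)
    (c : ℤ) (h : C c * ∏ i, X i ^ γ i ∈ J n) : c = 0 := by
  have h1 := coeff_alt_of_mem n _ h
  let g : Fin n → Fin n := fun i => ⟨γ i, hlt i⟩
  have hg : Function.Injective g := fun i j hij => hγ (congrArg Fin.val hij)
  let τ : Equiv.Perm (Fin n) := Equiv.ofBijective g (Finite.injective_iff_bijective.mp hg)
  have hm : (C c * ∏ i, X i ^ γ i : MvPolynomial (Fin n) ℤ) =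
      monomial (Finsupp.equivFunOnFinite.symm γ) c := by
    rw [monomial_eq, Finsupp.prod_fintype]
    · rfl
    · simp
  rw [hm, alt_apply, coeff_sum, Finset.sum_eq_single τ] at h1
  · rw [coeff_smul, rename_monomial, coeff_monomial, if_pos] at h1
    · rcases Int.units_eq_one_or (Equiv.Perm.sign τ) with h2 | h2 <;> simpa [h2] using h1
    · ext i
      obtain ⟨i, rfl⟩ := τ.surjective i
      rw [Finsupp.mapDomain_apply τ.injective]
      rfl
  · intro σ _ hσ
    rw [coeff_smul, rename_monomial, coeff_monomial, if_neg, smul_zero]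
    intro h2
    apply hσ
    ext i
    have h3 := DFunLike.congr_fun h2 (σ i)
    rw [Finsupp.mapDomain_apply σ.injective] at h3
    exact h3.symm
  · simp

lemma X_pow_mem (n : ℕ) (i : Fin n) : (X i : MvPolynomial (Fin n) ℤ) ^ n ∈ J n := by
  have h := congrArg (Polynomial.eval (-X i)) (prod_C_add_X_eq_sum_esymm ℤ (Fin n))
  rw [Polynomial.eval_prod, Finset.prod_eq_zero (Finset.mem_univ i) (by simp),
    Polynomial.eval_finsetSum, Finset.sum_range_succ'] at h
  simp only [Polynomial.eval_mul, Polynomial.eval_C, Polynomial.eval_pow, Polynomial.eval_X,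
    Fintype.card_fin, esymm_zero, one_mul, Nat.sub_zero] at h
  have h2 : (-X i : MvPolynomial (Fin n) ℤ) ^ n ∈ J n := by
    rw [eq_neg_of_add_eq_zero_right h.symm]
    refine (J n).neg_mem (Ideal.sum_mem _ fun j hj => Ideal.mul_mem_right _ _ ?_)
    rw [Finset.mem_range] at hj
    exact Ideal.subset_span ⟨j + 1, by omega, by omega, rfl⟩
  rw [neg_pow] at h2
  have h3 := (J n).mul_mem_left ((-1) ^ n) h2
  rwa [← mul_assoc, ← mul_pow, neg_one_mul, neg_neg, one_pow, one_mul] at h3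

/-- Product of `-x_l` for `1 ≤ l < a`. -/
noncomputable def eul (n a : ℕ) : MvPolynomial (Fin n) ℤ :=
  ∏ ℓ ∈ Finset.univ.filter (fun ℓ : Fin n => 1 ≤ (ℓ : ℕ) ∧ (ℓ : ℕ) < a), (-X ℓ)

/-- The restriction map to the `k`-th flag subvariety. -/
noncomputable def res (n a : ℕ) (k : Fin n) :
    MvPolynomial (Fin n ⊕ Fin n) ℤ →ₐ[ℤ] MvPolynomial (Fin n) ℤ :=
  aeval (Sum.elim X (fun k' => if k' = k then eul n a else 0))

lemma res_x (n a : ℕ) (k j : Fin n) : res n a k (xv n j) = X j := by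
  simp [res, xv]

lemma res_y (n a : ℕ) (k j : Fin n) : res n a k (yv n j) = if j = k then eul n a else 0 := by
  simp [res, yv]

lemma prod_pos_mem (n : ℕ) (hn : 1 < n) :
    (∏ ℓ ∈ Finset.univ.filter (fun ℓ : Fin n => 1 ≤ (ℓ : ℕ)), (-X ℓ : MvPolynomial (Fin n) ℤ)) *
      X ⟨0, by omega⟩ ^ (n - 1) ∈ J n := by
  have h : esymm (Fin n) ℤ n =
      X ⟨0, by omega⟩ * ∏ ℓ ∈ Finset.univ.filter (fun ℓ : Fin n => 1 ≤ (ℓ : ℕ)), X ℓ := by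
    have h1 : esymm (Fin n) ℤ n = ∏ ℓ : Fin n, X ℓ := by
      have : Finset.powersetCard n (Finset.univ : Finset (Fin n)) = {Finset.univ} := by
        have := Finset.powersetCard_self (Finset.univ : Finset (Fin n))
        rwa [Finset.card_univ, Fintype.card_fin] at this
      rw [esymm, this, Finset.sum_singleton]
    rw [h1, ← Finset.mul_prod_erase _ _ (Finset.mem_univ (⟨0, by omega⟩ : Fin n))]
    congr 1
    refine Finset.prod_congr ?_ fun _ _ => rfl
    ext i
    simp [Fin.ext_iff]
    omega
  have h2 : esymm (Fin n) ℤ n ∈ J n := Ideal.subset_span ⟨n, by omega, le_rfl, rfl⟩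
  rw [h] at h2
  obtain ⟨m, rfl⟩ : ∃ m, n = m + 2 := ⟨n - 2, by omega⟩
  rw [Finset.prod_neg]
  have h3 := (J (m + 2)).mul_mem_left
    ((-1) ^ (Finset.univ.filter (fun ℓ : Fin (m + 2) => 1 ≤ (ℓ : ℕ))).card * X ⟨0, by omega⟩ ^ m) h2
  convert h3 using 1
  rw [show m + 2 - 1 = m + 1 from rfl, pow_succ]
  ring

lemma mem_of_mem_Ih (n a : ℕ) (hn : 0 < n) (ha : 1 ≤ a) (han : a < n) (k : Fin n)
    (p : MvPolynomial (Fin n ⊕ Fin n) ℤ) (hp : p ∈ Ih n a hn) :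
    res n a k p * X ⟨0, hn⟩ ^ (n - 1) ∈ J n := by
  have hx : ∀ q : MvPolynomial (Fin n) ℤ, X ⟨0, hn⟩ ∣ q → q * X ⟨0, hn⟩ ^ (n - 1) ∈ J n := by
    rintro q ⟨r, rfl⟩
    have h := (J n).mul_mem_left r (X_pow_mem n ⟨0, hn⟩)
    convert h using 1
    obtain ⟨m, rfl⟩ : ∃ m, n = m + 1 := ⟨n - 1, by omega⟩
    rw [show m + 1 - 1 = m from rfl, pow_succ]
    ring
  have hle : Ih n a hn ≤ Ideal.comap (res n a k)
      ((J n).colon {(X ⟨0, hn⟩ : MvPolynomial (Fin n) ℤ) ^ (n - 1)}) := by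
    refine Ideal.span_le.mpr ?_
    intro p hp
    rw [SetLike.mem_coe, Ideal.mem_comap, Submodule.mem_colon_singleton, smul_eq_mul]
    rcases hp with ⟨i, j, hij, rfl⟩ | ⟨i, rfl⟩ | ⟨i, rfl⟩ | rfl | ⟨i, hi, hi', rfl⟩
    · rw [map_mul, res_y, res_y]
      by_cases h : i = k
      · rw [if_neg (fun h' : j = k => hij (h.trans h'.symm))]
        simp
      · simp [h]
    · apply hx
      rw [map_mul, res_x]
      exact dvd_mul_right _ _
    · rw [map_sub, map_mul, map_prod, map_prod, res_y]
      simp only [map_neg, res_x]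
      split_ifs with h
      · convert (J n).zero_mem
        rw [eul, mul_comm (Finset.prod _ _), ← Finset.prod_union]
        · rw [sub_eq_zero.mpr, zero_mul]
          refine Finset.prod_congr ?_ fun _ _ => rfl
          ext i
          simp
          omega
        · rw [Finset.disjoint_left]
          intro i
          simp
      · rw [mul_zero, zero_sub, neg_mul]
        exact (J n).neg_mem (prod_pos_mem n (by omega))
    · apply hx
      rw [map_sub, map_sum, map_prod]
      simp only [map_sub, res_x, res_y]
      rw [Finset.sum_ite_eq' Finset.univ k, if_pos (Finset.mem_univ _), eul,
        ← Ideal.mem_span_singleton, ← Ideal.Quotient.eq, map_prod, map_prod]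
      refine Finset.prod_congr rfl fun i _ => ?_
      rw [Ideal.Quotient.eq, Ideal.mem_span_singleton]
      exact ⟨-1, by ring⟩
    · apply Ideal.mul_mem_right
      have : res n a k (rename Sum.inl (esymm (Fin n) ℤ i)) = esymm (Fin n) ℤ i := by
        rw [res, aeval_rename, Sum.elim_comp_inl, aeval_X_left_apply]
      rw [this]
      exact Ideal.subset_span ⟨i, hi, hi', rfl⟩
  have := hle hp
  rwa [Ideal.mem_comap, Submodule.mem_colon_singleton, smul_eq_mul] at this

/-- The exponent vector `(N; 1, …, j-1, 0, j, …, N-1)`. -/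
def gam (N j : ℕ) (i : Fin (N + 1)) : ℕ :=
  if (i : ℕ) = 0 then N else if (i : ℕ) < j then i else if (i : ℕ) = j then 0 else i - 1

lemma res_mono_dvd (N a : ℕ) (k : Fin (N + 1)) (ℓ : Fin N → ℕ)
    (hbd : ∀ j : Fin N, ℓ j ≤ N - 1 - (j : ℕ)) (m : Fin N) (hm : (m : ℕ) < N + 1 - a)
    (hm0 : ℓ m = 0) (ha : 1 ≤ a) :
    res (N + 1) a k (mono (N + 1) N.succ_pos ℓ) * eul (N + 1) a * X 0 ^ N ∣
      ∏ i, (X i : MvPolynomial (Fin (N + 1)) ℤ) ^ gam N (N - m) i := by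
  have h1 : res (N + 1) a k (mono (N + 1) N.succ_pos ℓ) =
      ∏ i : Fin N, (X i.succ : MvPolynomial (Fin (N + 1)) ℤ) ^ ℓ i.rev := by
    rw [mono, map_prod, ← Equiv.prod_comp Fin.revPerm]
    refine Finset.prod_congr rfl fun i _ => ?_
    rw [map_pow, res_x]
    congr 2
    ext
    simp [Fin.val_rev]
    omega
  have h2 : eul (N + 1) a =
      ∏ i : Fin N, if (i : ℕ) + 1 < a then -(X i.succ : MvPolynomial (Fin (N + 1)) ℤ) else 1 := by
    rw [eul, Finset.prod_filter, Fin.prod_univ_succ]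
    simp
  rw [h1, h2, ← Finset.prod_mul_distrib, Fin.prod_univ_succ, mul_comm]
  refine mul_dvd_mul ?_ (Finset.prod_dvd_prod_of_dvd _ _ fun i _ => ?_)
  · simp [gam]
  · have hb := hbd i.rev
    rw [Fin.val_rev] at hb
    have hz : (i : ℕ) + 1 = N - m → ℓ i.rev = 0 := by
      intro h
      have : i.rev = m := by
        ext
        rw [Fin.val_rev]
        omega
      rw [this, hm0]
    have hg : gam N (N - m) i.succ =
        if (i : ℕ) + 1 < N - m then (i : ℕ) + 1 else if (i : ℕ) + 1 = N - m then 0 else i := by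
      simp [gam]
    have hi := i.isLt
    split_ifs with h
    · rw [mul_neg, neg_dvd, ← pow_succ]
      apply pow_dvd_pow
      rw [hg, if_pos (by omega)]
      omega
    · rw [mul_one]
      apply pow_dvd_pow
      rw [hg]
      split_ifs with h3 h4
      · omega
      · rw [hz h4]
      · omega

lemma gam_lt (N j : ℕ) (hj : 1 ≤ j) (i : Fin (N + 1)) : gam N j i < N + 1 := by
  unfold gam
  split_ifs <;> omega

lemma gam_inj (N j : ℕ) (hj : 1 ≤ j) (hj' : j ≤ N) : Function.Injective (gam N j) := by
  intro s t h
  unfold gam at h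
  ext
  split_ifs at h <;> omega

theorem stmt13 (n a : ℕ) (hn : 0 < n) (ha : 1 ≤ a) (han : a < n)
    (ℓ : Fin (n - 1) → ℕ)
    (hbd : ∀ j : Fin (n - 1), ℓ j ≤ n - 2 - (j : ℕ))
    (hzero : ∃ m : Fin (n - 1), (m : ℕ) < n - a ∧ ℓ m = 0) :
    LinearIndependent ℤ (fun k : Fin n =>
      Ideal.Quotient.mk (Ih n a hn) (mono n hn ℓ * yv n k)) := by
  obtain ⟨m, hm, hm0⟩ := hzero
  obtain ⟨N, rfl⟩ : ∃ N, n = N + 1 := ⟨n - 1, by omega⟩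
  rw [Fintype.linearIndependent_iff]
  intro c hc k
  have hmem : ∑ i, C (c i) * (mono (N + 1) hn ℓ * yv (N + 1) i) ∈ Ih (N + 1) a hn := by
    rw [← Ideal.Quotient.eq_zero_iff_mem, map_sum, ← hc]
    refine Finset.sum_congr rfl fun i _ => ?_
    rw [← smul_eq_C_mul, map_zsmul]
  have h1 := mem_of_mem_Ih (N + 1) a hn ha han k _ hmem
  have h2 : res (N + 1) a k (∑ i, C (c i) * (mono (N + 1) hn ℓ * yv (N + 1) i)) =
      C (c k) * (res (N + 1) a k (mono (N + 1) hn ℓ) * eul (N + 1) a) := by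
    rw [map_sum, Finset.sum_eq_single k]
    · rw [map_mul, map_mul, res_y, if_pos rfl]
      congr 1
      exact (res (N + 1) a k).commutes (c k)
    · intro i _ hi
      rw [map_mul, map_mul, res_y, if_neg hi, mul_zero, mul_zero]
    · simp
  rw [h2] at h1
  obtain ⟨g, hg⟩ := res_mono_dvd N a k ℓ hbd m hm hm0 ha
  have hmN : (m : ℕ) < N := m.isLt
  refine coeff_alt_monomial (N + 1) (gam N (N - m)) (gam_inj N _ (by omega) (by omega))
    (gam_lt N _ (by omega)) (c k) ?_
  rw [hg]
  have h3 := (J (N + 1)).mul_mem_left g h1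
  convert h3 using 1
  rw [show N + 1 - 1 = N from rfl, show (⟨0, hn⟩ : Fin (N + 1)) = 0 from rfl]
  ring

end Stmt13
end

section
/- Let n ≥ 2 and 1 ≤ a ≤ n, and let A = ℂ[x_1,…,x_n,y_1,…,y_n]/I_h be the complex presentation of H^*(Hess(S,h)) for h = (a,n,…,n), with the S_n-action σ·x_i = x_i, σ·y_i = y_{σ(i)}. Then, as a ℂ[S_n]-module, A is isomorphic to the direct sum of (n−a)·(n−2)! copies of the natural permutation representation ℂ^n (with S_n permuting the standard basis vectors) and n·(a−1)·(n−2)! copies of the trivial representation. -/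
open MvPolynomial

namespace Stmt14

noncomputable def xv (n : ℕ) (j : Fin n) : MvPolynomial (Fin n ⊕ Fin n) ℂ :=
  X (Sum.inl j)

noncomputable def yv (n : ℕ) (k : Fin n) : MvPolynomial (Fin n ⊕ Fin n) ℂ :=
  X (Sum.inr k)

/-- The ideal I_h over ℂ, for h = (a,n,…,n). -/
noncomputable def Ih (n a : ℕ) (hn : 0 < n) : Ideal (MvPolynomial (Fin n ⊕ Fin n) ℂ) :=
  Ideal.span
    {p | (∃ k k' : Fin n, k ≠ k' ∧ p = yv n k * yv n k') ∨
         (∃ k : Fin n, p = xv n ⟨0, hn⟩ * yv n k) ∨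
         (∃ k : Fin n, p =
            (∏ ℓ ∈ Finset.univ.filter (fun ℓ : Fin n => a ≤ (ℓ : ℕ)), (-xv n ℓ)) * yv n k -
              ∏ ℓ ∈ Finset.univ.filter (fun ℓ : Fin n => 1 ≤ (ℓ : ℕ)), (-xv n ℓ)) ∨
         (p = (∑ k : Fin n, yv n k) -
            ∏ ℓ ∈ Finset.univ.filter (fun ℓ : Fin n => 1 ≤ (ℓ : ℕ) ∧ (ℓ : ℕ) < a),
              (xv n ⟨0, hn⟩ - xv n ℓ)) ∨
         (∃ i : ℕ, 1 ≤ i ∧ i ≤ n ∧ p = rename Sum.inl (esymm (Fin n) ℂ i))}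

/-- The quotient algebra A = ℂ[x,y]/I_h. -/
noncomputable abbrev A (n a : ℕ) (hn : 0 < n) :=
  MvPolynomial (Fin n ⊕ Fin n) ℂ ⧸ Ih n a hn

end Stmt14
namespace Stmt14

/-- span of monomials of weight `< d` -/
noncomputable def Lw {σ : Type} (w : σ → ℕ) (d : ℕ) : Submodule ℂ (MvPolynomial σ ℂ) :=
  Submodule.span ℂ {p | ∃ m : σ →₀ ℕ, Finsupp.weight w m < d ∧ p = monomial m 1}

/-- span of monomials of weight `= d` -/
noncomputable def Hw {σ : Type} (w : σ → ℕ) (d : ℕ) : Submodule ℂ (MvPolynomial σ ℂ) :=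
  Submodule.span ℂ {p | ∃ m : σ →₀ ℕ, Finsupp.weight w m = d ∧ p = monomial m 1}

theorem mem_Hw {σ : Type} {w : σ → ℕ} {d : ℕ} {p : MvPolynomial σ ℂ}
    (hp : IsWeightedHomogeneous w p d) : p ∈ Hw w d := by
  rw [p.as_sum]
  refine Submodule.sum_mem _ fun m hm => ?_
  have : monomial m (coeff m p) = coeff m p • (monomial m (1 : ℂ)) := by
    rw [smul_monomial]; simp
  rw [this]
  exact Submodule.smul_mem _ _ (Submodule.subset_span ⟨m, hp (mem_support_iff.mp hm), rfl⟩)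

theorem Hw_le {σ : Type} (w : σ → ℕ) {d e : ℕ} (h : d < e) : Hw w d ≤ Lw w e := by
  apply Submodule.span_mono
  rintro p ⟨m, hm, rfl⟩
  exact ⟨m, by omega, rfl⟩

theorem Lw_mono {σ : Type} (w : σ → ℕ) {d e : ℕ} (h : d ≤ e) : Lw w d ≤ Lw w e := by
  apply Submodule.span_mono
  rintro p ⟨m, hm, rfl⟩
  exact ⟨m, by omega, rfl⟩

theorem Lw_mul {σ : Type} (w : σ → ℕ) (d e : ℕ) {p q : MvPolynomial σ ℂ} (hp : p ∈ Lw w d)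
    (hq : q ∈ Lw w (e + 1)) : p * q ∈ Lw w (d + e) := by
  have h : Lw w d * Lw w (e + 1) ≤ Lw w (d + e) := by
    unfold Lw
    rw [Submodule.span_mul_span]
    apply Submodule.span_mono
    rintro _ ⟨_, ⟨m, hm, rfl⟩, _, ⟨m', hm', rfl⟩, rfl⟩
    refine ⟨m + m', by rw [map_add]; omega, by simp [monomial_mul]⟩
  exact h (Submodule.mul_mem_mul hp hq)

theorem exists_proj {F : Type} [AddCommGroup F] [Module ℂ F] (U : Submodule ℂ F) :
    ∃ π : F →ₗ[ℂ] F, (∀ f ∈ U, π f = 0) ∧ ∀ f, f - π f ∈ U := by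
  obtain ⟨g, hg⟩ := LinearMap.exists_leftInverse_of_injective U.subtype U.ker_subtype
  refine ⟨LinearMap.id - U.subtype ∘ₗ g, ?_, ?_⟩
  · intro f hf
    have := LinearMap.congr_fun hg ⟨f, hf⟩
    simp at this
    simp [this]
  · intro f
    simp

theorem abstract_lower {σ : Type} (w : σ → ℕ) {F : Type} [CommRing F] [Algebra ℂ F]
    (ev : MvPolynomial σ ℂ →ₐ[ℂ] F) (hev : Function.Surjective ev)
    (G : Set (MvPolynomial σ ℂ))
    (hG : ∀ g ∈ G, ∃ d, IsWeightedHomogeneous w g d ∧ ∃ h ∈ Lw w d, ev g = ev h) :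
    ∃ Φ : MvPolynomial σ ℂ →ₗ[ℂ] F, Function.Surjective Φ ∧ ∀ p ∈ Ideal.span G, Φ p = 0 := by
  choose π hπ0 hπ1 using fun d : ℕ => exists_proj ((Lw w d).map ev.toLinearMap)
  let Φ : MvPolynomial σ ℂ →ₗ[ℂ] F :=
    (basisMonomials σ ℂ).constr ℂ fun m => π (Finsupp.weight w m) (ev (monomial m 1))
  have hΦm : ∀ m, Φ (monomial m 1) = π (Finsupp.weight w m) (ev (monomial m 1)) := by
    intro m
    have := (basisMonomials σ ℂ).constr_basis ℂ
      (fun m => π (Finsupp.weight w m) (ev (monomial m 1))) m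
    rwa [coe_basisMonomials] at this
  have hΦ : ∀ d, ∀ p ∈ Hw w d, Φ p = π d (ev p) := by
    intro d p hp
    have h : Hw w d ≤ LinearMap.eqLocus Φ (π d ∘ₗ ev.toLinearMap) := by
      apply Submodule.span_le.2
      rintro _ ⟨m, hm, rfl⟩
      subst hm
      simpa using hΦm m
    simpa using h hp
  refine ⟨Φ, ?_, ?_⟩
  · have key : ∀ d, ∀ p ∈ Lw w d, ev p ∈ LinearMap.range Φ := by
      intro d
      induction d with
      | zero =>
        intro p hp
        have : Lw w 0 = ⊥ := by
          unfold Lw; simp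
        rw [this, Submodule.mem_bot] at hp
        subst hp; simp
      | succ d ih =>
        intro p hp
        have h : Lw w (d + 1) ≤ (LinearMap.range Φ).comap ev.toLinearMap := by
          apply Submodule.span_le.2
          rintro _ ⟨m, hm, rfl⟩
          show ev (monomial m 1) ∈ LinearMap.range Φ
          obtain ⟨q, hq, hq'⟩ := hπ1 (Finsupp.weight w m) (ev (monomial m 1))
          have h1 := ih q (Lw_mono w (by omega) hq)
          have h2 : ev (monomial m 1) = ev q + Φ (monomial m 1) := by
            rw [hΦm]
            have : ev q = ev (monomial m 1) - π (Finsupp.weight w m) (ev (monomial m 1)) := hq'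
            rw [this]; ring
          rw [h2]
          exact Submodule.add_mem _ h1 ⟨_, rfl⟩
        exact h hp
    intro f
    obtain ⟨p, rfl⟩ := hev f
    rw [p.as_sum, map_sum]
    refine Submodule.sum_mem (LinearMap.range Φ) fun m hm => key (Finsupp.weight w m + 1) _ ?_
    exact Hw_le w (Nat.lt_succ_self _) (mem_Hw (isWeightedHomogeneous_monomial w m _ rfl))
  · intro p hp
    have hspan : ∀ q : MvPolynomial σ ℂ, ∀ g ∈ G, Φ (q * g) = 0 := by
      intro q g hg
      obtain ⟨d, hd, h, hh, hgh⟩ := hG g hg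
      rw [q.as_sum, Finset.sum_mul, map_sum]
      refine Finset.sum_eq_zero fun m _ => ?_
      have hm := isWeightedHomogeneous_monomial w m (coeff m q) rfl
      rw [hΦ _ _ (mem_Hw (hm.mul hd))]
      apply hπ0
      refine ⟨h * monomial m (coeff m q), ?_, ?_⟩
      · rw [SetLike.mem_coe, add_comm]
        exact Lw_mul w _ _ hh (Hw_le w (Nat.lt_succ_self _) (mem_Hw hm))
      · simp [hgh, mul_comm]
    refine Submodule.span_induction (p := fun x _ => ∀ q, Φ (q * x) = 0) ?_ ?_ ?_ ?_ hp 1 |> fun h => by simpa using h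
    · intro x hx q; exact hspan q x hx
    · simp
    · intro x y _ _ hx hy q; rw [mul_add, map_add, hx, hy, add_zero]
    · intro a x _ hx q; rw [smul_eq_mul, ← mul_assoc]; exact hx _

/-- `q` is the leading form of `p` in degree `d`. -/
def Lead {σ : Type} (w : σ → ℕ) (d : ℕ) (p q : MvPolynomial σ ℂ) : Prop :=
  IsWeightedHomogeneous w q d ∧ q - p ∈ Lw w d

theorem Lead.mul {σ : Type} {w : σ → ℕ} {d e : ℕ} {p q p' q' : MvPolynomial σ ℂ}
    (h : Lead w d p q) (h' : Lead w e p' q') : Lead w (d + e) (p * p') (q * q') := by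
  refine ⟨h.1.mul h'.1, ?_⟩
  have e1 : q * q' - p * p' = (q - p) * q' + (q' - p') * q - (q - p) * (q' - p') := by ring
  rw [e1]
  refine Submodule.sub_mem _ (Submodule.add_mem _ ?_ ?_) ?_
  · exact Lw_mul w d e h.2 (Hw_le w (Nat.lt_succ_self _) (mem_Hw h'.1))
  · rw [add_comm]
    exact Lw_mul w e d h'.2 (Hw_le w (Nat.lt_succ_self _) (mem_Hw h.1))
  · exact Lw_mul w d e h.2 (Lw_mono w (Nat.le_succ _) h'.2)

theorem Lead.sub {σ : Type} {w : σ → ℕ} {d : ℕ} {p q p' q' : MvPolynomial σ ℂ}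
    (h : Lead w d p q) (h' : Lead w d p' q') : Lead w d (p - p') (q - q') := by
  refine ⟨h.1.sub h'.1, ?_⟩
  have : q - q' - (p - p') = (q - p) - (q' - p') := by ring
  rw [this]
  exact Submodule.sub_mem _ h.2 h'.2

theorem Lead.refl {σ : Type} {w : σ → ℕ} {d : ℕ} {q : MvPolynomial σ ℂ}
    (h : IsWeightedHomogeneous w q d) : Lead w d q q := ⟨h, by simp⟩

theorem Lead.add_C {σ : Type} {w : σ → ℕ} {d : ℕ} (hd : 0 < d) {q : MvPolynomial σ ℂ} (c : ℂ)
    (h : IsWeightedHomogeneous w q d) : Lead w d (C c + q) q := by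
  refine ⟨h, ?_⟩
  have : q - (C c + q) = - C c := by ring
  rw [this]
  exact Submodule.neg_mem _ (Hw_le w hd (mem_Hw (isWeightedHomogeneous_C w c)))

theorem Lead.prod {σ : Type} {w : σ → ℕ} {ι : Type} (s : Finset ι) (p q : ι → MvPolynomial σ ℂ)
    (h : ∀ i ∈ s, Lead w 1 (p i) (q i)) : Lead w s.card (∏ i ∈ s, p i) (∏ i ∈ s, q i) := by
  classical
  induction s using Finset.induction_on with
  | empty => simpa using Lead.refl (isWeightedHomogeneous_one ℂ w)
  | insert i s hi ih =>
    rw [Finset.prod_insert hi, Finset.prod_insert hi, Finset.card_insert_of_notMem hi, add_comm]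
    exact (h i (by simp)).mul (ih fun j hj => h j (by simp [hj]))

end Stmt14
namespace Stmt14

noncomputable def tt {n : ℕ} (j : Fin n) : ℂ := ((j : ℕ) : ℂ)

theorem tt_inj {n : ℕ} : Function.Injective (tt (n := n)) := by
  intro i j h
  unfold tt at h
  exact Fin.ext (by exact_mod_cast h)

/-- coordinates of the deformed points -/
noncomputable def pt (n a : ℕ) (hn : 0 < n) : Fin n ⊕ Fin n → (Equiv.Perm (Fin n) → ℂ) :=
  Sum.elim (fun i π => tt (π i))
    (fun k π => if π ⟨0, hn⟩ = k then
      ∏ ℓ ∈ Finset.univ.filter (fun ℓ : Fin n => 1 ≤ (ℓ : ℕ) ∧ (ℓ : ℕ) < a),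
        (tt (π ⟨0, hn⟩) - tt (π ℓ)) else 0)

noncomputable def ev (n a : ℕ) (hn : 0 < n) :
    MvPolynomial (Fin n ⊕ Fin n) ℂ →ₐ[ℂ] (Equiv.Perm (Fin n) → ℂ) := aeval (pt n a hn)

theorem ev_x (n a : ℕ) (hn : 0 < n) (i : Fin n) (π : Equiv.Perm (Fin n)) :
    ev n a hn (xv n i) π = tt (π i) := by
  simp [ev, xv, pt]

theorem ev_y (n a : ℕ) (hn : 0 < n) (k : Fin n) (π : Equiv.Perm (Fin n)) :
    ev n a hn (yv n k) π = if π ⟨0, hn⟩ = k then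
      ∏ ℓ ∈ Finset.univ.filter (fun ℓ : Fin n => 1 ≤ (ℓ : ℕ) ∧ (ℓ : ℕ) < a),
        (tt (π ⟨0, hn⟩) - tt (π ℓ)) else 0 := by
  simp [ev, yv, pt]

theorem ev_C (n a : ℕ) (hn : 0 < n) (c : ℂ) (π : Equiv.Perm (Fin n)) :
    ev n a hn (C c) π = c := by
  simp [ev, algebraMap]

theorem ev_surj (n a : ℕ) (hn : 0 < n) : Function.Surjective (ev n a hn) := by
  classical
  rw [← AlgHom.coe_toLinearMap, ← LinearMap.range_eq_top, eq_top_iff]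
  rintro f -
  have hf : f = ∑ π, f π • (Pi.single π (1 : ℂ) : Equiv.Perm (Fin n) → ℂ) := by
    ext τ
    simp [Finset.sum_apply, Pi.single_apply]
  rw [hf]
  refine Submodule.sum_mem _ fun π _ => Submodule.smul_mem _ _ ?_
  let q : MvPolynomial (Fin n ⊕ Fin n) ℂ :=
    ∏ i : Fin n, ∏ j ∈ Finset.univ.erase (π i), (xv n i - C (tt j))
  have hq : ∀ τ, ev n a hn q τ = ∏ i : Fin n, ∏ j ∈ Finset.univ.erase (π i), (tt (τ i) - tt j) := by
    intro τ
    simp only [q, map_prod, Finset.prod_apply, map_sub, Pi.sub_apply, ev_x, ev_C]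
  have h0 : ev n a hn q π ≠ 0 := by
    rw [hq]
    refine Finset.prod_ne_zero_iff.2 fun i _ => Finset.prod_ne_zero_iff.2 fun j hj => ?_
    rw [sub_ne_zero]
    intro h
    exact (Finset.mem_erase.1 hj).1 (tt_inj h).symm
  refine ⟨(ev n a hn q π)⁻¹ • q, ?_⟩
  rw [map_smul]
  ext τ
  rcases eq_or_ne τ π with rfl | hne
  · simp [h0]
  · have : ∃ i, τ i ≠ π i := by
      by_contra! h
      exact hne (Equiv.ext h)
    obtain ⟨i, hi⟩ := this
    have hz : ev n a hn q τ = 0 := by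
      rw [hq]
      refine Finset.prod_eq_zero (Finset.mem_univ i) (Finset.prod_eq_zero (i := τ i) ?_ (sub_self _))
      simp [hi]
    simp [hne, hz]

def wt (n a : ℕ) : Fin n ⊕ Fin n → ℕ := Sum.elim (fun _ => 1) (fun _ => a - 1)

theorem hom_x (n a : ℕ) (i : Fin n) : IsWeightedHomogeneous (wt n a) (xv n i) 1 :=
  isWeightedHomogeneous_X ℂ (wt n a) (Sum.inl i)

theorem hom_y (n a : ℕ) (i : Fin n) : IsWeightedHomogeneous (wt n a) (yv n i) (a - 1) :=
  isWeightedHomogeneous_X ℂ (wt n a) (Sum.inr i)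

theorem hom_e (n a i : ℕ) :
    IsWeightedHomogeneous (wt n a) (rename Sum.inl (esymm (Fin n) ℂ i)) i := by
  unfold esymm
  rw [map_sum]
  apply IsWeightedHomogeneous.sum
  intro t ht
  rw [map_prod]
  have := IsWeightedHomogeneous.prod t
    (fun i => (rename Sum.inl (X i : MvPolynomial (Fin n) ℂ) : MvPolynomial (Fin n ⊕ Fin n) ℂ))
    (fun _ => 1) (w := wt n a) (fun i _ => by rw [rename_X]; exact hom_x n a i)
  simpa [(Finset.mem_powersetCard.1 ht).2] using this

theorem card_ge (n a : ℕ) : (Finset.univ.filter (fun ℓ : Fin n => a ≤ (ℓ : ℕ))).card = n - a := by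
  rw [← Nat.card_Ico, ← Finset.card_map Fin.valEmbedding]
  congr 1
  ext i
  simp only [Finset.mem_map, Finset.mem_filter, Finset.mem_univ, true_and, Fin.valEmbedding_apply,
    Finset.mem_Ico]
  constructor
  · rintro ⟨x, hx, rfl⟩
    exact ⟨hx, x.2⟩
  · rintro ⟨h1, h2⟩
    exact ⟨⟨i, h2⟩, h1, rfl⟩

theorem card_mid (n a : ℕ) (han : a ≤ n) :
    (Finset.univ.filter (fun ℓ : Fin n => 1 ≤ (ℓ : ℕ) ∧ (ℓ : ℕ) < a)).card = a - 1 := by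
  rw [← Nat.card_Ico, ← Finset.card_map Fin.valEmbedding]
  congr 1
  ext i
  simp only [Finset.mem_map, Finset.mem_filter, Finset.mem_univ, true_and, Fin.valEmbedding_apply,
    Finset.mem_Ico]
  constructor
  · rintro ⟨x, hx, rfl⟩
    exact hx
  · rintro ⟨h1, h2⟩
    exact ⟨⟨i, by omega⟩, ⟨h1, h2⟩, rfl⟩

theorem split_prod (n a : ℕ) (ha : 1 ≤ a) {M : Type} [CommMonoid M] (f : Fin n → M) :
    (∏ ℓ ∈ Finset.univ.filter (fun ℓ : Fin n => a ≤ (ℓ : ℕ)), f ℓ) *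
      (∏ ℓ ∈ Finset.univ.filter (fun ℓ : Fin n => 1 ≤ (ℓ : ℕ) ∧ (ℓ : ℕ) < a), f ℓ) =
    ∏ ℓ ∈ Finset.univ.filter (fun ℓ : Fin n => 1 ≤ (ℓ : ℕ)), f ℓ := by
  classical
  rw [← Finset.prod_union]
  · congr 1
    ext ℓ
    simp
    omega
  · rw [Finset.disjoint_left]
    intro ℓ
    simp
    omega

theorem lead_neg (n a : ℕ) (i : Fin n) (c : ℂ) : Lead (wt n a) 1 (C c - xv n i) (- xv n i) := by
  rw [sub_eq_add_neg]
  exact Lead.add_C one_pos c (hom_x n a i).neg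

theorem lower (n a : ℕ) (hn : 0 < n) (ha : 1 ≤ a) (han : a ≤ n) :
    ∃ Φ : A n a hn →ₗ[ℂ] (Equiv.Perm (Fin n) → ℂ), Function.Surjective Φ := by
  have hlead : ∀ {d : ℕ} {g p : MvPolynomial (Fin n ⊕ Fin n) ℂ}, Lead (wt n a) d p g →
      ev n a hn p = 0 → ∃ d, IsWeightedHomogeneous (wt n a) g d ∧
        ∃ h ∈ Lw (wt n a) d, ev n a hn g = ev n a hn h := by
    intro d g p h h0
    exact ⟨d, h.1, g - p, h.2, by rw [map_sub, h0, sub_zero]⟩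
  obtain ⟨Φ, hΦ, hI⟩ := abstract_lower (wt n a) (ev n a hn) (ev_surj n a hn)
    {p | (∃ k k' : Fin n, k ≠ k' ∧ p = yv n k * yv n k') ∨
         (∃ k : Fin n, p = xv n ⟨0, hn⟩ * yv n k) ∨
         (∃ k : Fin n, p =
            (∏ ℓ ∈ Finset.univ.filter (fun ℓ : Fin n => a ≤ (ℓ : ℕ)), (-xv n ℓ)) * yv n k -
              ∏ ℓ ∈ Finset.univ.filter (fun ℓ : Fin n => 1 ≤ (ℓ : ℕ)), (-xv n ℓ)) ∨
         (p = (∑ k : Fin n, yv n k) -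
            ∏ ℓ ∈ Finset.univ.filter (fun ℓ : Fin n => 1 ≤ (ℓ : ℕ) ∧ (ℓ : ℕ) < a),
              (xv n ⟨0, hn⟩ - xv n ℓ)) ∨
         (∃ i : ℕ, 1 ≤ i ∧ i ≤ n ∧ p = rename Sum.inl (esymm (Fin n) ℂ i))} (by
    rintro g (⟨k, k', hk, rfl⟩ | ⟨k, rfl⟩ | ⟨k, rfl⟩ | rfl | ⟨i, hi, hin, rfl⟩)
    · refine hlead (Lead.refl ((hom_y n a k).mul (hom_y n a k'))) ?_
      ext π
      simp only [map_mul, Pi.mul_apply, ev_y, Pi.zero_apply]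
      split_ifs with h1 h2
      · exact absurd (h1.symm.trans h2) hk
      all_goals simp
    · refine hlead ((Lead.add_C one_pos (- tt k) (hom_x n a ⟨0, hn⟩)).mul
        (Lead.refl (hom_y n a k))) ?_
      ext π
      simp only [map_mul, map_add, Pi.add_apply, Pi.mul_apply, ev_y, ev_C, ev_x, Pi.zero_apply]
      split_ifs with h1
      · simp [h1]
      · simp
    · have l1 := (Lead.prod (w := wt n a) (Finset.univ.filter (fun ℓ : Fin n => a ≤ (ℓ : ℕ))) _ _
        (fun ℓ _ => lead_neg n a ℓ (tt k))).mul (Lead.refl (hom_y n a k))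
      have l2 := (Lead.prod (w := wt n a) (Finset.univ.filter (fun ℓ : Fin n => 1 ≤ (ℓ : ℕ))) _ _
        (fun ℓ _ => lead_neg n a ℓ (tt k)))
      rw [card_ge] at l1 l2
      have e1 : n - a + (a - 1) = n - 1 := by omega
      rw [e1] at l1
      refine hlead (l1.sub l2) ?_
      ext π
      simp only [map_sub, map_mul, map_prod, Finset.prod_apply, Pi.sub_apply, Pi.mul_apply, ev_y,
        ev_C, ev_x, Pi.zero_apply]
      split_ifs with h1
      · rw [h1, split_prod n a ha (fun ℓ => tt k - tt (π ℓ)), sub_self]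
      · rw [mul_zero, zero_sub, neg_eq_zero]
        apply Finset.prod_eq_zero (i := π.symm k)
        · rw [Finset.mem_filter]
          refine ⟨Finset.mem_univ _, ?_⟩
          by_contra h
          apply h1
          have : π.symm k = ⟨0, hn⟩ := Fin.ext (by simpa using h)
          rw [← this]; simp
        · simp
    · refine hlead (d := a - 1) (Lead.refl (IsWeightedHomogeneous.sub ?_ ?_)) ?_
      · exact IsWeightedHomogeneous.sum _ _ _ fun k _ => hom_y n a k
      · have := IsWeightedHomogeneous.prod
          (Finset.univ.filter (fun ℓ : Fin n => 1 ≤ (ℓ : ℕ) ∧ (ℓ : ℕ) < a))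
          (fun ℓ => xv n ⟨0, hn⟩ - xv n ℓ) (fun _ => 1) (w := wt n a)
          (fun ℓ _ => (hom_x n a _).sub (hom_x n a _))
        simpa [card_mid n a han] using this
      · ext π
        simp only [map_sub, map_sum, map_prod, Finset.sum_apply, Finset.prod_apply, Pi.sub_apply,
          ev_y, ev_x, Pi.zero_apply]
        simp
    · refine hlead (Lead.add_C hi (- (aeval tt (esymm (Fin n) ℂ i))) (hom_e n a i)) ?_
      ext π
      rw [map_add, Pi.add_apply, ev_C, Pi.zero_apply]
      have : ev n a hn (rename Sum.inl (esymm (Fin n) ℂ i)) π = aeval tt (esymm (Fin n) ℂ i) := by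
        have h1 : ev n a hn (rename Sum.inl (esymm (Fin n) ℂ i)) π
            = aeval (tt ∘ π) (esymm (Fin n) ℂ i) := by
          simp [esymm, map_sum, map_prod, Finset.sum_apply, Finset.prod_apply, ev, pt]
        rw [h1, ← aeval_rename, rename_esymm]
      rw [this]; simp)
  exact ⟨Submodule.liftQ ((Ih n a hn).restrictScalars ℂ) Φ (fun p hp => hI p hp), by
    intro f
    obtain ⟨p, rfl⟩ := hΦ f
    exact ⟨Ideal.Quotient.mk _ p, rfl⟩⟩

end Stmt14
namespace Stmt14

section span
open scoped Polynomial Pointwise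

variable {D : Type} [CommRing D] [Algebra ℂ D]

theorem coeff_quot (K : Subalgebra ℂ D) (z : D) (hz : z ∈ K) (Q : D[X])
    (h : ∀ j, ((Polynomial.X - Polynomial.C z) * Q).coeff j ∈ K) : ∀ j, Q.coeff j ∈ K := by
  have key : ∀ k j, Q.natDegree + 1 ≤ j + k → Q.coeff j ∈ K := by
    intro k
    induction k with
    | zero =>
      intro j hj
      rw [Polynomial.coeff_eq_zero_of_natDegree_lt (by omega)]
      exact K.zero_mem
    | succ k ih =>
      intro j hj
      have h1 := h (j + 1)
      rw [sub_mul, Polynomial.coeff_sub, Polynomial.coeff_X_mul, Polynomial.coeff_C_mul] at h1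
      have h2 := K.add_mem h1 (K.mul_mem hz (ih (j + 1) (by omega)))
      simpa using h2
  intro j
  exact key (Q.natDegree + 1) j (by omega)

theorem adjoin_le [DecidableEq D] (K : Subalgebra ℂ D) (z : D) (P : D[X]) (hP : P.Monic)
    (hK : ∀ j, P.coeff j ∈ K) (hz : P.eval z = 0) :
    Subalgebra.toSubmodule (K ⊔ Algebra.adjoin ℂ {z}) ≤
      Subalgebra.toSubmodule K *
        Submodule.span ℂ ((Finset.range P.natDegree).image (fun j => z ^ j) : Finset D) := by
  classical
  set U := Subalgebra.toSubmodule K *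
        Submodule.span ℂ (((Finset.range P.natDegree).image (fun j => z ^ j) : Finset D) : Set D)
    with hU
  have hKU : ∀ c ∈ K, ∀ u ∈ U, c * u ∈ U := by
    intro c hc u hu
    have : Subalgebra.toSubmodule K * U ≤ U := by
      rw [hU, ← mul_assoc, K.isIdempotentElem_toSubmodule.eq]
    exact this (Submodule.mul_mem_mul hc hu)
  have hpow : ∀ j, z ^ j ∈ U := by
    intro j
    induction j using Nat.strong_induction_on with
    | _ j ih =>
      by_cases hj : j < P.natDegree
      · have := Submodule.mul_mem_mul (M := Subalgebra.toSubmodule K) (N := Submodule.span ℂ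
          (((Finset.range P.natDegree).image (fun j => z ^ j) : Finset D) : Set D))
          ((Subalgebra.mem_toSubmodule K).2 K.one_mem)
          (Submodule.subset_span (by simpa using ⟨j, hj, rfl⟩) : z ^ j ∈ _)
        rwa [one_mul] at this
      · have h1 : z ^ P.natDegree = - ∑ i ∈ Finset.range P.natDegree, P.coeff i * z ^ i := by
          have := hz
          rw [hP.as_sum] at this
          simp only [Polynomial.eval_add, Polynomial.eval_pow, Polynomial.eval_X, Polynomial.eval_finsetSum,
            Polynomial.eval_mul, Polynomial.eval_C] at this
          exact eq_neg_of_add_eq_zero_left this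
        have h2 : z ^ j = z ^ (j - P.natDegree) * z ^ P.natDegree := by
          rw [← pow_add]; congr 1; omega
        rw [h2, h1, mul_neg, Finset.mul_sum]
        refine Submodule.neg_mem _ (Submodule.sum_mem _ fun i hi => ?_)
        have h3 : z ^ (j - P.natDegree) * (P.coeff i * z ^ i)
            = P.coeff i * z ^ (j - P.natDegree + i) := by rw [pow_add]; ring
        rw [h3]
        refine hKU _ (hK i) _ (ih _ ?_)
        have := Finset.mem_range.1 hi
        omega
  have hzU : ∀ u ∈ U, z * u ∈ U := by
    intro u hu
    refine Submodule.mul_induction_on hu ?_ ?_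
    · intro c hc v hv
      rw [mul_left_comm]
      refine hKU c hc _ ?_
      have : Submodule.span ℂ (((Finset.range P.natDegree).image (fun j => z ^ j) : Finset D) : Set D)
          ≤ U.comap (LinearMap.mulLeft ℂ z) := by
        apply Submodule.span_le.2
        intro x hx
        rw [Finset.mem_coe, Finset.mem_image] at hx
        obtain ⟨j, -, rfl⟩ := hx
        show z * z ^ j ∈ U
        rw [← pow_succ']
        exact hpow _
      exact this hv
    · intro x y hx hy
      rw [mul_add]
      exact U.add_mem hx hy
  intro x hx
  have hx' : x ∈ Algebra.adjoin ℂ ((K : Set D) ∪ {z}) := by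
    rw [Algebra.adjoin_union, Algebra.adjoin_eq]
    exact hx
  have : ∀ u ∈ U, x * u ∈ U := by
    refine Algebra.adjoin_induction (p := fun x _ => ∀ u ∈ U, x * u ∈ U) ?_ ?_ ?_ ?_ hx'
    · rintro x (hx | rfl)
      · exact hKU x hx
      · exact hzU
    · intro r u hu
      rw [← Algebra.smul_def]
      exact U.smul_mem r hu
    · intro x y _ _ h1 h2 u hu
      rw [add_mul]
      exact U.add_mem (h1 u hu) (h2 u hu)
    · intro x y _ _ h1 h2 u hu
      rw [mul_assoc]
      exact h1 _ (h2 u hu)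
  have h1 := this 1 (by simpa using hpow 0)
  rwa [mul_one] at h1

theorem span_fact {ι : Type} [DecidableEq ι] (z : ι → D) (s : Finset ι) : ∀ (K : Subalgebra ℂ D),
    K ⊔ Algebra.adjoin ℂ (z '' s) = ⊤ →
    (∀ j, (∏ i ∈ s, (Polynomial.X - Polynomial.C (z i))).coeff j ∈ K) →
    ∃ T : Finset D, T.card ≤ s.card.factorial ∧
      Subalgebra.toSubmodule K * Submodule.span ℂ (T : Set D) = ⊤ := by
  classical
  induction s using Finset.induction_on with
  | empty =>
    intro K hK _
    refine ⟨{1}, by simp, ?_⟩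
    have : K = ⊤ := by simpa using hK
    rw [this, Finset.coe_singleton, ← Submodule.one_eq_span, mul_one]
    simp
  | insert i s hi ih =>
    intro K hK hc
    rcases subsingleton_or_nontrivial D with hD | hD
    · exact ⟨∅, by simp, Subsingleton.elim _ _⟩
    obtain ⟨T, hT, hT'⟩ := ih (K ⊔ Algebra.adjoin ℂ {z i}) (by
      rw [sup_assoc, ← Algebra.adjoin_union, ← hK]
      congr 2
      simp [Set.image_insert_eq]) (by
      apply coeff_quot _ (z i)
      · exact (le_sup_right : _ ≤ K ⊔ Algebra.adjoin ℂ {z i}) (Algebra.subset_adjoin rfl)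
      · intro j
        have := hc j
        rw [Finset.prod_insert hi] at this
        exact (le_sup_left : K ≤ K ⊔ Algebra.adjoin ℂ {z i}) this)
    have h1 := adjoin_le K (z i) _ (Polynomial.monic_prod_of_monic (insert i s) _
      fun j _ => Polynomial.monic_X_sub_C (z j)) hc (by
      rw [Finset.prod_insert hi]; simp)
    rw [Polynomial.natDegree_finsetProd_X_sub_C_eq_card, Finset.card_insert_of_notMem hi] at h1
    refine ⟨(Finset.range (s.card + 1)).image (fun j => z i ^ j) * T, ?_, ?_⟩
    · rw [Finset.card_insert_of_notMem hi, Nat.factorial_succ]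
      refine Finset.card_mul_le.trans (Nat.mul_le_mul ?_ hT)
      exact Finset.card_image_le.trans (by simp)
    · rw [Finset.coe_mul, ← Submodule.span_mul_span, ← mul_assoc, eq_top_iff, ← hT']
      exact mul_le_mul' h1 le_rfl

end span

end Stmt14
namespace Stmt14

section cov
open scoped Polynomial Pointwise

def Cov {S : Type} [CommRing S] [Algebra ℂ S] (J : Ideal S) (N : ℕ) : Prop :=
  ∃ s : Finset S, s.card ≤ N ∧ ∀ p, ∃ q ∈ Submodule.span ℂ (s : Set S), p - q ∈ J

theorem Cov.mul {S : Type} [CommRing S] [Algebra ℂ S] {J : Ideal S} {f g : S} {N M : ℕ}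
    (hf : Cov (J ⊔ Ideal.span {f}) N) (hg : Cov (J ⊔ Ideal.span {g}) M) :
    Cov (J ⊔ Ideal.span {f * g}) (N + M) := by
  classical
  obtain ⟨s, hs, h1⟩ := hf
  obtain ⟨t, ht, h2⟩ := hg
  refine ⟨s ∪ t.image (fun x => f * x), ?_, ?_⟩
  · have := Finset.card_union_le s (t.image (fun x => f * x))
    have := Finset.card_image_le (s := t) (f := fun x => f * x)
    omega
  · intro p
    obtain ⟨q, hq, hpq⟩ := h1 p
    obtain ⟨j, hj, x, hx, hjx⟩ := Submodule.mem_sup.1 hpq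
    obtain ⟨r, rfl⟩ := Ideal.mem_span_singleton'.1 hx
    obtain ⟨q', hq', hpq'⟩ := h2 r
    obtain ⟨j', hj', x', hx', hjx'⟩ := Submodule.mem_sup.1 hpq'
    obtain ⟨r', rfl⟩ := Ideal.mem_span_singleton'.1 hx'
    refine ⟨q + f * q', ?_, ?_⟩
    · rw [Finset.coe_union]
      refine Submodule.add_mem _ (Submodule.span_mono Set.subset_union_left hq)
        (Submodule.span_mono Set.subset_union_right ?_)
      rw [Finset.coe_image]
      have := Submodule.mem_map_of_mem (f := LinearMap.mulLeft ℂ f) hq'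
      rw [Submodule.map_span] at this
      exact this
    · have : p - (q + f * q') = (j + f * j') + r' * (f * g) := by
        have e1 : p = q + j + r * f := by rw [add_assoc, hjx]; ring
        have e2 : r = q' + j' + r' * g := by rw [add_assoc, hjx']; ring
        rw [e1, e2]; ring
      rw [this]
      exact Submodule.add_mem_sup (J.add_mem hj (J.mul_mem_left _ hj'))
        (Ideal.mem_span_singleton'.2 ⟨_, rfl⟩)

theorem Cov.prod {S : Type} [CommRing S] [Algebra ℂ S] {J : Ideal S} {ι : Type} (s : Finset ι)
    (f : ι → S) (N : ℕ) (h : ∀ i ∈ s, Cov (J ⊔ Ideal.span {f i}) N) :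
    Cov (J ⊔ Ideal.span {∏ i ∈ s, f i}) (s.card * N) := by
  classical
  induction s using Finset.induction_on with
  | empty =>
    refine ⟨∅, by simp, fun p => ⟨0, by simp, ?_⟩⟩
    simp
  | insert i s hi ih =>
    rw [Finset.prod_insert hi, Finset.card_insert_of_notMem hi, add_mul, one_mul, add_comm]
    exact (h i (by simp)).mul (ih fun j hj => h j (by simp [hj]))

theorem cov_of_span {S : Type} [CommRing S] [Algebra ℂ S] {J : Ideal S} {N : ℕ}
    (T : Finset (S ⧸ J)) (hT : T.card ≤ N) (h : Submodule.span ℂ (T : Set (S ⧸ J)) = ⊤) :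
    Cov J N := by
  classical
  have hsurj := Ideal.Quotient.mk_surjective (I := J)
  refine ⟨T.image (Function.surjInv hsurj), Finset.card_image_le.trans hT, fun p => ?_⟩
  have hp : Ideal.Quotient.mk J p ∈ Submodule.span ℂ (T : Set (S ⧸ J)) := by rw [h]; trivial
  have hT' : (T : Set (S ⧸ J)) = (Ideal.Quotient.mkₐ ℂ J).toLinearMap ''
      (T.image (Function.surjInv hsurj) : Finset S) := by
    rw [Finset.coe_image, ← Set.image_comp]
    symm
    convert Set.image_id _
    ext x
    exact Function.surjInv_eq hsurj x
  rw [hT', ← Submodule.map_span] at hp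
  obtain ⟨q, hq, hqp⟩ := hp
  refine ⟨q, hq, ?_⟩
  rw [← Ideal.Quotient.eq]
  exact hqp.symm

noncomputable def Je (n : ℕ) : Ideal (MvPolynomial (Fin n) ℂ) :=
  Ideal.span {p | ∃ i : ℕ, 1 ≤ i ∧ i ≤ n ∧ p = esymm (Fin n) ℂ i}

theorem prod_eq_pow (n : ℕ) {J : Ideal (MvPolynomial (Fin n) ℂ)} (hJ : Je n ≤ J) :
    ∏ i : Fin n, (Polynomial.X - Polynomial.C (Ideal.Quotient.mk J (X i)))
      = (Polynomial.X ^ n : (MvPolynomial (Fin n) ℂ ⧸ J)[X]) := by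
  have h := Multiset.prod_X_sub_X_eq_sum_esymm
    ((Finset.univ : Finset (Fin n)).val.map fun i => Ideal.Quotient.mk J (X i))
  rw [Multiset.map_map] at h
  have h0 : ∏ i : Fin n, (Polynomial.X - Polynomial.C (Ideal.Quotient.mk J (X i))) =
    (Multiset.map ((fun t => Polynomial.X - Polynomial.C t) ∘ fun i => Ideal.Quotient.mk J (X i))
      (Finset.univ : Finset (Fin n)).val).prod := rfl
  rw [h0, h, Finset.sum_eq_single 0]
  · have : ∀ m : Multiset (MvPolynomial (Fin n) ℂ ⧸ J), m.esymm 0 = 1 := fun m => by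
      simp [Multiset.esymm]
    rw [this]; simp
  · intro i hi hi0
    have hin : i ≤ n := by
      have := Finset.mem_range.1 hi
      simp at this
      omega
    have : ((Finset.univ : Finset (Fin n)).val.map fun i => Ideal.Quotient.mk J (X i)).esymm i = 0 := by
      rw [← aeval_esymm_eq_multiset_esymm (Fin n) ℂ]
      have e : aeval (fun i => Ideal.Quotient.mk J (X i)) (esymm (Fin n) ℂ i)
          = Ideal.Quotient.mk J (esymm (Fin n) ℂ i) := by
        have : (aeval (fun i => Ideal.Quotient.mk J (X i)) :
          MvPolynomial (Fin n) ℂ →ₐ[ℂ] _) = Ideal.Quotient.mkₐ ℂ J := by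
          ext i; simp
        rw [this]; rfl
      rw [e, Ideal.Quotient.eq_zero_iff_mem]
      exact hJ (Ideal.subset_span ⟨i, by omega, hin, rfl⟩)
    rw [this]; simp
  · simp

theorem adjoin_all (n : ℕ) (J : Ideal (MvPolynomial (Fin n) ℂ))
    (K : Subalgebra ℂ (MvPolynomial (Fin n) ℂ ⧸ J)) (h : ∀ i, Ideal.Quotient.mk J (X i) ∈ K) :
    K = ⊤ := by
  rw [eq_top_iff]
  rintro x -
  obtain ⟨p, rfl⟩ := Ideal.Quotient.mk_surjective x
  induction p using MvPolynomial.induction_on with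
  | C c => exact K.algebraMap_mem c
  | add p q hp hq => rw [map_add]; exact K.add_mem hp hq
  | mul_X p i hp => rw [map_mul]; exact K.mul_mem hp (h i)

theorem prod_split (n : ℕ) {M : Type} [CommMonoid M] (f : Fin n → M) {i j : Fin n} (hij : i ≠ j) :
    ∏ l, f l = f i * (f j * ∏ l ∈ (Finset.univ.erase i).erase j, f l) := by
  rw [Finset.mul_prod_erase _ _ (by simp [hij.symm]), Finset.mul_prod_erase _ _ (by simp)]

theorem card_split (n : ℕ) {i j : Fin n} (hij : i ≠ j) :
    ((Finset.univ.erase i).erase j).card = n - 2 := by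
  rw [Finset.card_erase_of_mem (by simp [hij.symm]), Finset.card_erase_of_mem (by simp)]
  simp
  omega

theorem cov1 (n : ℕ) (hn : 2 ≤ n) {J : Ideal (MvPolynomial (Fin n) ℂ)} (hJ : Je n ≤ J) {i j : Fin n}
    (hij : i ≠ j) (hi : X i ∈ J) (hj : X j ∈ J) : Cov J (n - 2).factorial := by
  have hi' := Ideal.Quotient.eq_zero_iff_mem.2 hi
  have hj' := Ideal.Quotient.eq_zero_iff_mem.2 hj
  obtain ⟨T, hT, hT'⟩ := span_fact (fun l => Ideal.Quotient.mk J (X l))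
    ((Finset.univ.erase i).erase j) ⊥ (by
      apply adjoin_all
      intro l
      by_cases hli : l = i
      · rw [hli, hi']; exact Subalgebra.zero_mem _
      by_cases hlj : l = j
      · rw [hlj, hj']; exact Subalgebra.zero_mem _
      refine (le_sup_right : _ ≤ ⊥ ⊔ Algebra.adjoin ℂ _) (Algebra.subset_adjoin ⟨l, ?_, rfl⟩)
      simp [hli, hlj]) (by
      have h := prod_eq_pow n hJ
      rw [prod_split n _ hij, hi', hj'] at h
      have e : ∏ l ∈ (Finset.univ.erase i).erase j,
          (Polynomial.X - Polynomial.C (Ideal.Quotient.mk J (X l))) = Polynomial.X ^ (n - 2) := by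
        have h2 : (Polynomial.X ^ n : (MvPolynomial (Fin n) ℂ ⧸ J)[X])
          = Polynomial.X * (Polynomial.X * Polynomial.X ^ (n - 2)) := by
          rw [← pow_succ', ← pow_succ']; congr 1; omega
        rw [h2] at h
        simp only [map_zero, sub_zero] at h
        exact Polynomial.isRegular_X.left (Polynomial.isRegular_X.left h)
      intro l
      rw [e, Polynomial.coeff_X_pow]
      split_ifs
      · exact Subalgebra.one_mem _
      · exact Subalgebra.zero_mem _)
  rw [card_split n hij] at hT
  refine cov_of_span T hT ?_
  rw [← hT', Algebra.toSubmodule_bot, one_mul]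

theorem cov2 (n : ℕ) (hn : 2 ≤ n) {J : Ideal (MvPolynomial (Fin n) ℂ)} (hJ : Je n ≤ J) {i j : Fin n}
    (hij : i ≠ j) (hi : X i - X j ∈ J) : Cov J (n - 1).factorial := by
  classical
  rcases subsingleton_or_nontrivial (MvPolynomial (Fin n) ℂ ⧸ J) with hD | hD
  · exact cov_of_span ∅ (by simp) (Subsingleton.elim _ _)
  have hi' := Ideal.Quotient.eq.2 hi
  set z := Ideal.Quotient.mk J (X i) with hz
  have h := prod_eq_pow n hJ
  rw [prod_split n _ hij, ← hi', ← hz] at h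
  set R := ∏ l ∈ (Finset.univ.erase i).erase j,
          (Polynomial.X - Polynomial.C (Ideal.Quotient.mk J (X l))) with hR
  have hz0 : z ^ (n - 1) = 0 := by
    have h1 := congrArg (fun p => Polynomial.eval z (Polynomial.derivative p)) h
    simp [Polynomial.derivative_X_pow] at h1
    have h2 : (algebraMap ℂ (MvPolynomial (Fin n) ℂ ⧸ J) (n : ℂ)⁻¹) * ((n : MvPolynomial (Fin n) ℂ ⧸ J) * z ^ (n - 1)) = 0 := by
      rw [← h1, mul_zero]
    rw [← mul_assoc, ← map_natCast (algebraMap ℂ (MvPolynomial (Fin n) ℂ ⧸ J)), ← map_mul,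
      inv_mul_cancel₀ (by exact_mod_cast (by omega : n ≠ 0)), map_one, one_mul] at h2
    exact h2
  have hpow : ∀ (K : Subalgebra ℂ (MvPolynomial (Fin n) ℂ ⧸ J)) (m l : ℕ),
      (Polynomial.X ^ m : (MvPolynomial (Fin n) ℂ ⧸ J)[X]).coeff l ∈ K := by
    intro K m l
    rw [Polynomial.coeff_X_pow]
    split_ifs
    · exact Subalgebra.one_mem _
    · exact Subalgebra.zero_mem _
  have hK := adjoin_le ⊥ z (Polynomial.X ^ (n - 1)) (Polynomial.monic_X_pow _) (hpow _ _)
    (by simp [hz0])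
  rw [Polynomial.natDegree_X_pow] at hK
  have hzK : z ∈ ⊥ ⊔ Algebra.adjoin ℂ {z} :=
    (le_sup_right : _ ≤ ⊥ ⊔ Algebra.adjoin ℂ {z}) (Algebra.subset_adjoin rfl)
  obtain ⟨T, hT, hT'⟩ := span_fact (fun l => Ideal.Quotient.mk J (X l))
    ((Finset.univ.erase i).erase j) (⊥ ⊔ Algebra.adjoin ℂ {z}) (by
      apply adjoin_all
      intro l
      by_cases hli : l = i
      · rw [hli]; exact (le_sup_left : _ ≤ (⊥ ⊔ Algebra.adjoin ℂ {z}) ⊔ _) hzK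
      by_cases hlj : l = j
      · rw [hlj, ← hi']; exact (le_sup_left : _ ≤ (⊥ ⊔ Algebra.adjoin ℂ {z}) ⊔ _) hzK
      refine (le_sup_right : _ ≤ (⊥ ⊔ Algebra.adjoin ℂ {z}) ⊔ Algebra.adjoin ℂ _)
        (Algebra.subset_adjoin ⟨l, ?_, rfl⟩)
      simp [hli, hlj]) (by
      apply coeff_quot _ z hzK
      apply coeff_quot _ z hzK
      rw [h]
      exact hpow _ _)
  rw [card_split n hij] at hT
  refine cov_of_span ((Finset.range (n - 1)).image (fun j => z ^ j) * T) ?_ ?_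
  · have : (n - 1).factorial = (n - 1) * (n - 2).factorial := by
      obtain ⟨m, rfl⟩ : ∃ m, n = m + 2 := ⟨n - 2, by omega⟩
      exact Nat.factorial_succ m
    rw [this]
    refine Finset.card_mul_le.trans (Nat.mul_le_mul ?_ hT)
    exact Finset.card_image_le.trans (by simp)
  · rw [Finset.coe_mul, ← Submodule.span_mul_span, eq_top_iff, ← hT']
    refine mul_le_mul' (hK.trans ?_) le_rfl
    rw [Algebra.toSubmodule_bot, one_mul]

end cov

end Stmt14
namespace Stmt14

theorem exists_pad {S : Type} [Zero S] (s : Finset S) (N : ℕ) (h : s.card ≤ N) :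
    ∃ m : Fin N → S, ∀ x ∈ s, ∃ i, m i = x := by
  refine ⟨fun i => if h : (i : ℕ) < s.card then (s.equivFin.symm ⟨i, h⟩ : S) else 0, ?_⟩
  intro x hx
  refine ⟨⟨s.equivFin ⟨x, hx⟩, lt_of_lt_of_le (Fin.is_lt _) h⟩, ?_⟩
  simp

section final
variable (n a : ℕ) (hn : 0 < n)

noncomputable def yy (k : Fin n) : A n a hn := Ideal.Quotient.mk (Ih n a hn) (yv n k)

noncomputable def psi : MvPolynomial (Fin n) ℂ →ₐ[ℂ] A n a hn :=
  (Ideal.Quotient.mkₐ ℂ (Ih n a hn)).comp (rename Sum.inl)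

noncomputable def QQ : MvPolynomial (Fin n) ℂ :=
  ∏ ℓ ∈ Finset.univ.filter (fun ℓ : Fin n => a ≤ (ℓ : ℕ)), (- X ℓ)

noncomputable def PP : MvPolynomial (Fin n) ℂ :=
  ∏ ℓ ∈ Finset.univ.filter (fun ℓ : Fin n => 1 ≤ (ℓ : ℕ) ∧ (ℓ : ℕ) < a), (X ⟨0, hn⟩ - X ℓ)

noncomputable def PP' : MvPolynomial (Fin n) ℂ :=
  ∏ ℓ ∈ Finset.univ.filter (fun ℓ : Fin n => 1 ≤ (ℓ : ℕ) ∧ (ℓ : ℕ) < a), (- X ℓ)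

noncomputable def Pi' : MvPolynomial (Fin n) ℂ :=
  ∏ ℓ ∈ Finset.univ.filter (fun ℓ : Fin n => 1 ≤ (ℓ : ℕ)), (- X ℓ)

theorem psi_X (i : Fin n) : psi n a hn (X i) = Ideal.Quotient.mk (Ih n a hn) (xv n i) := by
  simp [psi, xv]

theorem r1 {k k' : Fin n} (h : k ≠ k') : yy n a hn k * yy n a hn k' = 0 := by
  unfold yy
  rw [← map_mul, Ideal.Quotient.eq_zero_iff_mem]
  exact Ideal.subset_span (Or.inl ⟨k, k', h, rfl⟩)

theorem r2 (k : Fin n) : psi n a hn (X ⟨0, hn⟩) * yy n a hn k = 0 := by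
  rw [psi_X]
  unfold yy
  rw [← map_mul, Ideal.Quotient.eq_zero_iff_mem]
  exact Ideal.subset_span (Or.inr (Or.inl ⟨k, rfl⟩))

theorem r3 (k : Fin n) : psi n a hn (QQ n a) * yy n a hn k = psi n a hn (Pi' n) := by
  unfold QQ Pi' yy
  simp only [map_prod, map_neg, psi_X]
  simp only [← map_neg, ← map_prod]
  rw [← map_mul, Ideal.Quotient.eq]
  exact Ideal.subset_span (Or.inr (Or.inr (Or.inl ⟨k, rfl⟩)))

theorem r4 : ∑ k, yy n a hn k = psi n a hn (PP n a hn) := by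
  unfold PP yy
  simp only [map_prod, map_sub, psi_X]
  simp only [← map_sub, ← map_prod, ← map_sum]
  rw [Ideal.Quotient.eq]
  exact Ideal.subset_span (Or.inr (Or.inr (Or.inr (Or.inl rfl))))

theorem r5 (p : MvPolynomial (Fin n) ℂ) (hp : p ∈ Je n) : psi n a hn p = 0 := by
  have : Je n ≤ RingHom.ker (psi n a hn) := by
    apply Ideal.span_le.2
    rintro _ ⟨i, h1, h2, rfl⟩
    show psi n a hn _ = 0
    show Ideal.Quotient.mk (Ih n a hn) _ = 0
    rw [Ideal.Quotient.eq_zero_iff_mem]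
    exact Ideal.subset_span (Or.inr (Or.inr (Or.inr (Or.inr ⟨i, h1, h2, rfl⟩))))
  exact this hp

theorem r6 (hn1 : 0 < n) : psi n a hn1 (X ⟨0, hn⟩) * psi n a hn1 (Pi' n) = 0 := by
  rw [← r3 n a hn ⟨0, hn⟩, mul_left_comm, r2, mul_zero]

theorem r7 (hn2 : 2 ≤ n) (ha : 1 ≤ a) : psi n a hn (PP' n a) * psi n a hn (Pi' n) = 0 := by
  have h1 : QQ n a * PP' n a = Pi' n := split_prod n a ha fun ℓ => - X ℓ
  have h2 : (⟨0, hn⟩ : Fin n) ≠ ⟨1, hn2⟩ := by simp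
  calc psi n a hn (PP' n a) * psi n a hn (Pi' n)
      = psi n a hn (PP' n a) * (psi n a hn (QQ n a) * yy n a hn ⟨0, hn⟩) := by rw [r3]
    _ = psi n a hn (QQ n a * PP' n a) * yy n a hn ⟨0, hn⟩ := by rw [map_mul]; ring
    _ = psi n a hn (QQ n a) * yy n a hn ⟨1, hn2⟩ * yy n a hn ⟨0, hn⟩ := by rw [h1, r3]
    _ = 0 := by rw [mul_assoc, r1 n a hn h2.symm, mul_zero]

noncomputable def theta {N1 N2 : ℕ} (m1 : Fin N1 → MvPolynomial (Fin n) ℂ)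
    (m2 : Fin N2 → MvPolynomial (Fin n) ℂ) :
    ((Fin N1 → (Fin n → ℂ)) × (Fin N2 → ℂ)) →ₗ[ℂ] A n a hn where
  toFun t := (∑ p, ∑ k, t.1 p k • (psi n a hn (m1 p) * yy n a hn k)) +
    ∑ q, t.2 q • psi n a hn (m2 q)
  map_add' s t := by
    simp only [Prod.fst_add, Prod.snd_add, Pi.add_apply, add_smul, Finset.sum_add_distrib]
    abel
  map_smul' c t := by
    simp only [Prod.smul_fst, Prod.smul_snd, Pi.smul_apply, smul_eq_mul, mul_smul,
      Finset.smul_sum, smul_add, RingHom.id_apply]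

theorem theta_mem1 {N1 N2 : ℕ} (m1 : Fin N1 → MvPolynomial (Fin n) ℂ)
    (m2 : Fin N2 → MvPolynomial (Fin n) ℂ) (p : Fin N1) (k : Fin n) :
    psi n a hn (m1 p) * yy n a hn k ∈ LinearMap.range (theta n a hn m1 m2) := by
  classical
  refine ⟨(Pi.single p (Pi.single k 1), 0), ?_⟩
  simp only [theta, LinearMap.coe_mk, AddHom.coe_mk]
  rw [Finset.sum_eq_single p, Finset.sum_eq_single k]
  · simp
  · intro b _ hb; simp [hb]
  · simp
  · intro b _ hb; simp [hb]
  · simp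

theorem theta_mem2 {N1 N2 : ℕ} (m1 : Fin N1 → MvPolynomial (Fin n) ℂ)
    (m2 : Fin N2 → MvPolynomial (Fin n) ℂ) (q : Fin N2) :
    psi n a hn (m2 q) ∈ LinearMap.range (theta n a hn m1 m2) := by
  classical
  refine ⟨(0, Pi.single q 1), ?_⟩
  simp only [theta, LinearMap.coe_mk, AddHom.coe_mk]
  rw [Finset.sum_eq_single (s := Finset.univ) q]
  · simp
  · intro b _ hb; simp [hb]
  · simp

theorem upper (hn2 : 2 ≤ n) (ha : 1 ≤ a) (han : a ≤ n) :
    ∃ (m1 : Fin ((n - a) * Nat.factorial (n - 2)) → MvPolynomial (Fin n) ℂ)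
      (m2 : Fin (n * (a - 1) * Nat.factorial (n - 2)) → MvPolynomial (Fin n) ℂ),
      Function.Surjective (theta n a hn m1 m2) := by
  classical
  set x0 : Fin n := ⟨0, hn⟩ with hx0
  have ne0 : ∀ ℓ : Fin n, 1 ≤ (ℓ : ℕ) → x0 ≠ ℓ := by
    rintro ℓ h rfl
    simp [hx0] at h
  have c1 : Cov ((Je n ⊔ Ideal.span {X x0}) ⊔ Ideal.span {QQ n a}) ((n - a) * (n - 2).factorial) := by
    rw [← card_ge n a]
    refine Cov.prod _ _ _ fun ℓ hℓ => ?_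
    have h1 : 1 ≤ (ℓ : ℕ) := by simp at hℓ; omega
    refine cov1 n hn2 (le_sup_left.trans le_sup_left) (ne0 ℓ h1) ?_ ?_
    · exact Ideal.mem_sup_left (Ideal.mem_sup_right (Ideal.mem_span_singleton_self _))
    · refine Ideal.mem_sup_right (Ideal.mem_span_singleton'.2 ⟨-1, by ring⟩)
  have c3 : Cov ((Je n ⊔ Ideal.span {X x0}) ⊔ Ideal.span {PP' n a}) ((a - 1) * (n - 2).factorial) := by
    rw [← card_mid n a han]
    refine Cov.prod _ _ _ fun ℓ hℓ => ?_
    have h1 : 1 ≤ (ℓ : ℕ) := by simp at hℓ; omega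
    refine cov1 n hn2 (le_sup_left.trans le_sup_left) (ne0 ℓ h1) ?_ ?_
    · exact Ideal.mem_sup_left (Ideal.mem_sup_right (Ideal.mem_span_singleton_self _))
    · refine Ideal.mem_sup_right (Ideal.mem_span_singleton'.2 ⟨-1, by ring⟩)
  have c2 : Cov (Je n ⊔ Ideal.span {PP n a hn}) ((a - 1) * (n - 1).factorial) := by
    rw [← card_mid n a han]
    refine Cov.prod _ _ _ fun ℓ hℓ => ?_
    have h1 : 1 ≤ (ℓ : ℕ) := by simp at hℓ; omega
    refine cov2 n hn2 le_sup_left (ne0 ℓ h1) ?_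
    exact Ideal.mem_sup_right (Ideal.mem_span_singleton_self _)
  obtain ⟨s1, hs1, h1⟩ := c1
  obtain ⟨s2, hs2, h2⟩ := c2
  obtain ⟨s3, hs3, h3⟩ := c3
  obtain ⟨m1, hm1⟩ := exists_pad s1 _ hs1
  obtain ⟨m2, hm2⟩ := exists_pad (s2 ∪ s3.image (fun x => Pi' n * x))
    (n * (a - 1) * Nat.factorial (n - 2)) (by
      have e1 := Finset.card_union_le s2 (s3.image (fun x => Pi' n * x))
      have e2 := Finset.card_image_le (s := s3) (f := fun x => Pi' n * x)
      have e3 : n * (a - 1) * (n - 2).factorial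
          = (a - 1) * (n - 1).factorial + (a - 1) * (n - 2).factorial := by
        obtain ⟨m, rfl⟩ : ∃ m, n = m + 2 := ⟨n - 2, by omega⟩
        have : (m + 2 - 1).factorial = (m + 1) * (m + 2 - 2).factorial := Nat.factorial_succ m
        rw [this]; ring
      omega)
  refine ⟨m1, m2, ?_⟩
  set W := LinearMap.range (theta n a hn m1 m2) with hW
  have w1 : ∀ k, ∀ q ∈ Submodule.span ℂ (s1 : Set (MvPolynomial (Fin n) ℂ)),
      psi n a hn q * yy n a hn k ∈ W := by
    intro k q hq
    have : Submodule.span ℂ (s1 : Set (MvPolynomial (Fin n) ℂ)) ≤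
        W.comap (LinearMap.mulRight ℂ (yy n a hn k) ∘ₗ (psi n a hn).toLinearMap) := by
      apply Submodule.span_le.2
      intro x hx
      obtain ⟨i, rfl⟩ := hm1 x hx
      exact theta_mem1 n a hn m1 m2 i k
    exact this hq
  have w2 : ∀ q ∈ Submodule.span ℂ (s2 : Set (MvPolynomial (Fin n) ℂ)), psi n a hn q ∈ W := by
    intro q hq
    have : Submodule.span ℂ (s2 : Set (MvPolynomial (Fin n) ℂ)) ≤
        W.comap (psi n a hn).toLinearMap := by
      apply Submodule.span_le.2
      intro x hx
      obtain ⟨i, rfl⟩ := hm2 x (Finset.mem_union_left _ hx)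
      exact theta_mem2 n a hn m1 m2 i
    exact this hq
  have w3 : ∀ q ∈ Submodule.span ℂ (s3 : Set (MvPolynomial (Fin n) ℂ)),
      psi n a hn (Pi' n) * psi n a hn q ∈ W := by
    intro q hq
    have : Submodule.span ℂ (s3 : Set (MvPolynomial (Fin n) ℂ)) ≤
        W.comap (LinearMap.mulLeft ℂ (psi n a hn (Pi' n)) ∘ₗ (psi n a hn).toLinearMap) := by
      apply Submodule.span_le.2
      intro x hx
      obtain ⟨i, hi⟩ := hm2 (Pi' n * x) (Finset.mem_union_right _ (Finset.mem_image_of_mem _ hx))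
      have := theta_mem2 n a hn m1 m2 i
      rw [hi, map_mul] at this
      exact this
    exact this hq
  -- decomposition of elements
  have dec : ∀ {f g : MvPolynomial (Fin n) ℂ},
      g ∈ (Je n ⊔ Ideal.span {X x0}) ⊔ Ideal.span {f} →
      ∃ u v, psi n a hn g = psi n a hn (X x0) * u + psi n a hn f * psi n a hn v := by
    intro f g hg
    obtain ⟨b, hb, c, hc, rfl⟩ := Submodule.mem_sup.1 hg
    obtain ⟨d, hd, e, he, rfl⟩ := Submodule.mem_sup.1 hb
    obtain ⟨v, rfl⟩ := Ideal.mem_span_singleton'.1 hc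
    obtain ⟨u, rfl⟩ := Ideal.mem_span_singleton'.1 he
    refine ⟨psi n a hn u, v, ?_⟩
    simp only [map_add, map_mul, r5 n a hn d hd]
    ring
  -- multiples of Π
  have v1 : ∀ r, psi n a hn (Pi' n) * psi n a hn r ∈ W := by
    intro r
    obtain ⟨q, hq, hr⟩ := h3 r
    obtain ⟨u, v, huv⟩ := dec hr
    have e : psi n a hn r = psi n a hn q + psi n a hn (r - q) := by rw [← map_add]; congr 1; ring
    have : psi n a hn (Pi' n) * psi n a hn r = psi n a hn (Pi' n) * psi n a hn q := by
      rw [e, huv]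
      linear_combination u * r6 n a hn hn + psi n a hn v * r7 n a hn hn2 ha
    rw [this]
    exact w3 q hq
  -- multiples of P
  have v2 : ∀ r, psi n a hn (PP n a hn) * psi n a hn r ∈ W := by
    intro r
    obtain ⟨q, hq, hr⟩ := h1 r
    obtain ⟨u, v, huv⟩ := dec hr
    have e : psi n a hn r = psi n a hn q + psi n a hn (r - q) := by rw [← map_add]; congr 1; ring
    have e1 : psi n a hn (PP n a hn) * psi n a hn r = ∑ k,
        (psi n a hn q * yy n a hn k + psi n a hn (Pi' n) * psi n a hn v) := by
      rw [← r4, Finset.sum_mul]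
      refine Finset.sum_congr rfl fun k _ => ?_
      rw [e, huv]
      linear_combination u * r2 n a hn k + psi n a hn v * r3 n a hn k
    rw [e1]
    exact Submodule.sum_mem _ fun k _ => Submodule.add_mem _ (w1 k q hq) (v1 v)
  have v3 : ∀ r, psi n a hn r ∈ W := by
    intro r
    obtain ⟨q, hq, hr⟩ := h2 r
    obtain ⟨d, hd, c, hc, hdc⟩ := Submodule.mem_sup.1 hr
    obtain ⟨v, rfl⟩ := Ideal.mem_span_singleton'.1 hc
    have e : r = q + d + PP n a hn * v := by
      rw [add_assoc, mul_comm (PP n a hn), hdc]; ring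
    rw [e, map_add, map_add, r5 n a hn d hd, add_zero, map_mul]
    exact Submodule.add_mem _ (w2 q hq) (v2 v)
  have v4 : ∀ r k, psi n a hn r * yy n a hn k ∈ W := by
    intro r k
    obtain ⟨q, hq, hr⟩ := h1 r
    obtain ⟨u, v, huv⟩ := dec hr
    have e : psi n a hn r = psi n a hn q + psi n a hn (r - q) := by rw [← map_add]; congr 1; ring
    have e1 : psi n a hn r * yy n a hn k =
        psi n a hn q * yy n a hn k + psi n a hn (Pi' n) * psi n a hn v := by
      rw [e, huv]
      linear_combination u * r2 n a hn k + psi n a hn v * r3 n a hn k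
    rw [e1]
    exact Submodule.add_mem _ (w1 k q hq) (v1 v)
  -- everything
  let V : Submodule ℂ (A n a hn) := Submodule.span ℂ
    (Set.range (psi n a hn) ∪ Set.range fun t : MvPolynomial (Fin n) ℂ × Fin n =>
      psi n a hn t.1 * yy n a hn t.2)
  have hVW : V ≤ W := by
    apply Submodule.span_le.2
    rintro _ (⟨r, rfl⟩ | ⟨⟨r, k⟩, rfl⟩)
    · exact v3 r
    · exact v4 r k
  have hV : ∀ p, Ideal.Quotient.mk (Ih n a hn) p ∈ V := by
    intro p
    induction p using MvPolynomial.induction_on with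
    | C c => exact Submodule.subset_span (Or.inl ⟨C c, by simp [psi]; rfl⟩)
    | add p q hp hq => rw [map_add]; exact V.add_mem hp hq
    | mul_X p i hp =>
      rw [map_mul]
      have : V ≤ V.comap (LinearMap.mulRight ℂ (Ideal.Quotient.mk (Ih n a hn) (X i))) := by
        apply Submodule.span_le.2
        rintro _ (⟨r, rfl⟩ | ⟨⟨r, k⟩, rfl⟩)
        · show psi n a hn r * Ideal.Quotient.mk (Ih n a hn) (X i) ∈ V
          rcases i with i | i
          · have := psi_X n a hn i
            unfold xv at this
            rw [← this, ← map_mul]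
            exact Submodule.subset_span (Or.inl ⟨_, rfl⟩)
          · exact Submodule.subset_span (Or.inr ⟨(r, i), rfl⟩)
        · show psi n a hn r * yy n a hn k * Ideal.Quotient.mk (Ih n a hn) (X i) ∈ V
          rcases i with i | i
          · have := psi_X n a hn i
            unfold xv at this
            rw [← this, mul_right_comm, ← map_mul]
            exact Submodule.subset_span (Or.inr ⟨(_, k), rfl⟩)
          · show psi n a hn r * yy n a hn k * yy n a hn i ∈ V
            rcases eq_or_ne k i with rfl | hki
            · have e : yy n a hn k * yy n a hn k = psi n a hn (PP n a hn) * yy n a hn k := by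
                rw [← r4, Finset.sum_mul, Finset.sum_eq_single k]
                · intro b _ hb; exact r1 n a hn hb
                · simp
              rw [mul_assoc, e, ← mul_assoc, ← map_mul]
              exact Submodule.subset_span (Or.inr ⟨(_, k), rfl⟩)
            · rw [mul_assoc, r1 n a hn hki, mul_zero]
              exact V.zero_mem
      exact this hp
  intro x
  obtain ⟨p, rfl⟩ := Ideal.Quotient.mk_surjective x
  exact hVW (hV p)

/-- the action on polynomials -/
noncomputable def rho (σ : Equiv.Perm (Fin n)) :
    MvPolynomial (Fin n ⊕ Fin n) ℂ →ₐ[ℂ] MvPolynomial (Fin n ⊕ Fin n) ℂ :=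
  rename (Sum.map id σ)

theorem rho_x (σ : Equiv.Perm (Fin n)) (i : Fin n) : rho n σ (xv n i) = xv n i := by
  simp [rho, xv]

theorem rho_y (σ : Equiv.Perm (Fin n)) (i : Fin n) : rho n σ (yv n i) = yv n (σ i) := by
  simp [rho, yv]

theorem rho_le (σ : Equiv.Perm (Fin n)) : Ih n a hn ≤ Ideal.comap (rho n σ) (Ih n a hn) := by
  conv_lhs => unfold Ih
  apply Ideal.span_le.2
  rintro g (⟨k, k', hk, rfl⟩ | ⟨k, rfl⟩ | ⟨k, rfl⟩ | rfl | ⟨i, hi, hin, rfl⟩)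
  all_goals
    rw [SetLike.mem_coe, Ideal.mem_comap]
    refine Ideal.subset_span ?_
  · exact Or.inl ⟨σ k, σ k', by simpa using hk, by simp only [map_mul, rho_y]⟩
  · exact Or.inr (Or.inl ⟨σ k, by simp only [map_mul, rho_x, rho_y]⟩)
  · exact Or.inr (Or.inr (Or.inl ⟨σ k, by
      simp only [map_mul, map_sub, map_prod, map_neg, rho_x, rho_y]⟩))
  · refine Or.inr (Or.inr (Or.inr (Or.inl ?_)))
    simp only [map_sub, map_prod, map_sum, rho_x, rho_y]
    rw [Equiv.sum_comp σ (fun k => yv n k)]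
  · refine Or.inr (Or.inr (Or.inr (Or.inr ⟨i, hi, hin, ?_⟩)))
    rw [rho, rename_rename]
    rfl

noncomputable def actHom (σ : Equiv.Perm (Fin n)) : A n a hn →ₐ[ℂ] A n a hn :=
  Ideal.quotientMapₐ (Ih n a hn) (rho n σ) (rho_le n a hn σ)

theorem actHom_mk (σ : Equiv.Perm (Fin n)) (p : MvPolynomial (Fin n ⊕ Fin n) ℂ) :
    actHom n a hn σ (Ideal.Quotient.mk (Ih n a hn) p) = Ideal.Quotient.mk (Ih n a hn) (rho n σ p) :=
  rfl

theorem actHom_mul (σ τ : Equiv.Perm (Fin n)) (v : A n a hn) :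
    actHom n a hn (σ * τ) v = actHom n a hn σ (actHom n a hn τ v) := by
  obtain ⟨p, rfl⟩ := Ideal.Quotient.mk_surjective v
  rw [actHom_mk, actHom_mk, actHom_mk]
  congr 1
  simp only [rho, rename_rename]
  congr 2
  ext x
  rcases x with x | x <;> rfl

theorem actHom_one (v : A n a hn) : actHom n a hn 1 v = v := by
  obtain ⟨p, rfl⟩ := Ideal.Quotient.mk_surjective v
  rw [actHom_mk]
  congr 1
  have : Sum.map id ((1 : Equiv.Perm (Fin n)) : Fin n → Fin n) = (id : Fin n ⊕ Fin n → _) := by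
    ext x
    rcases x with x | x <;> rfl
  rw [rho, this, rename_id_apply]

noncomputable def actE (σ : Equiv.Perm (Fin n)) : A n a hn ≃ₐ[ℂ] A n a hn :=
  AlgEquiv.ofAlgHom (actHom n a hn σ) (actHom n a hn σ⁻¹)
    (by
      apply AlgHom.ext
      intro v
      rw [AlgHom.comp_apply, ← actHom_mul, mul_inv_cancel, actHom_one]; rfl)
    (by
      apply AlgHom.ext
      intro v
      rw [AlgHom.comp_apply, ← actHom_mul, inv_mul_cancel, actHom_one]; rfl)

theorem actE_apply (σ : Equiv.Perm (Fin n)) (v : A n a hn) :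
    actE n a hn σ v = actHom n a hn σ v := rfl

theorem act_psi (σ : Equiv.Perm (Fin n)) (p : MvPolynomial (Fin n) ℂ) :
    actHom n a hn σ (psi n a hn p) = psi n a hn p := by
  show Ideal.Quotient.mk (Ih n a hn) (rho n σ (rename Sum.inl p)) = _
  rw [rho, rename_rename]
  rfl

theorem act_yy (σ : Equiv.Perm (Fin n)) (k : Fin n) :
    actHom n a hn σ (yy n a hn k) = yy n a hn (σ k) := by
  unfold yy
  rw [actHom_mk, rho_y]

theorem act_theta {N1 N2 : ℕ} (m1 : Fin N1 → MvPolynomial (Fin n) ℂ)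
    (m2 : Fin N2 → MvPolynomial (Fin n) ℂ) (σ : Equiv.Perm (Fin n)) (t) :
    actHom n a hn σ (theta n a hn m1 m2 t) =
      theta n a hn m1 m2 (fun p i => t.1 p (σ⁻¹ i), t.2) := by
  simp only [theta, LinearMap.coe_mk, AddHom.coe_mk, map_add, map_sum, map_smul, map_mul, act_psi,
    act_yy]
  congr 1
  refine Finset.sum_congr rfl fun p _ => ?_
  rw [← Equiv.sum_comp σ (fun k => t.1 p (σ⁻¹ k) • (psi n a hn (m1 p) * yy n a hn k))]
  simp

end final

theorem stmt14 (n a : ℕ) (hn : 2 ≤ n) (ha : 1 ≤ a) (han : a ≤ n) :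
    ∃ act : Equiv.Perm (Fin n) → (A n a (by omega) ≃ₐ[ℂ] A n a (by omega)),
      (∀ σ τ : Equiv.Perm (Fin n), act (σ * τ) = (act τ).trans (act σ)) ∧
      (∀ (σ : Equiv.Perm (Fin n)) (i : Fin n),
        act σ (Ideal.Quotient.mk (Ih n a (by omega)) (xv n i))
          = Ideal.Quotient.mk (Ih n a (by omega)) (xv n i)) ∧
      (∀ (σ : Equiv.Perm (Fin n)) (k : Fin n),
        act σ (Ideal.Quotient.mk (Ih n a (by omega)) (yv n k))
          = Ideal.Quotient.mk (Ih n a (by omega)) (yv n (σ k))) ∧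
      ∃ e : A n a (by omega) ≃ₗ[ℂ]
          ((Fin ((n - a) * Nat.factorial (n - 2)) → (Fin n → ℂ)) ×
            (Fin (n * (a - 1) * Nat.factorial (n - 2)) → ℂ)),
        ∀ (σ : Equiv.Perm (Fin n)) (v : A n a (by omega)),
          (∀ (p : Fin ((n - a) * Nat.factorial (n - 2))) (i : Fin n),
            (e (act σ v)).1 p i = (e v).1 p (σ⁻¹ i)) ∧
          (e (act σ v)).2 = (e v).2 := by
  have hn0 : 0 < n := by omega
  obtain ⟨m1, m2, hθ⟩ := upper n a hn0 hn ha han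
  obtain ⟨Φ, hΦ⟩ := lower n a hn0 ha han
  have hfin : Module.finrank ℂ ((Fin ((n - a) * Nat.factorial (n - 2)) → (Fin n → ℂ)) ×
            (Fin (n * (a - 1) * Nat.factorial (n - 2)) → ℂ)) =
      Module.finrank ℂ (Equiv.Perm (Fin n) → ℂ) := by
    rw [Module.finrank_prod, Module.finrank_pi_fintype]
    simp only [Module.finrank_fintype_fun_eq_card, Fintype.card_fin, Finset.sum_const,
      Finset.card_univ, smul_eq_mul, Fintype.card_perm]
    obtain ⟨m, rfl⟩ : ∃ m, n = m + 2 := ⟨n - 2, by omega⟩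
    have h1 : (m + 2).factorial = (m + 2) * ((m + 1) * m.factorial) := by
      rw [Nat.factorial_succ, Nat.factorial_succ]
    have h2 : (m + 2 - a) + (a - 1) = m + 1 := by omega
    rw [h1, ← h2]
    simp only [Nat.add_sub_cancel]
    ring
  have hinj : Function.Injective (theta n a hn0 m1 m2) := by
    have h : Function.Injective (Φ ∘ₗ theta n a hn0 m1 m2) :=
      (LinearMap.injective_iff_surjective_of_finrank_eq_finrank hfin).2 (hΦ.comp hθ)
    exact Function.Injective.of_comp h
  let E := LinearEquiv.ofBijective (theta n a hn0 m1 m2) ⟨hinj, hθ⟩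
  refine ⟨actE n a hn0, ?_, ?_, ?_, E.symm, ?_⟩
  · intro σ τ
    apply AlgEquiv.ext
    intro v
    exact actHom_mul n a hn0 σ τ v
  · intro σ i
    rw [actE_apply, actHom_mk, rho_x]
  · intro σ k
    rw [actE_apply, actHom_mk, rho_y]
  · intro σ v
    obtain ⟨t, rfl⟩ := E.surjective v
    have h : actE n a hn0 σ (E t) = E (fun p i => t.1 p (σ⁻¹ i), t.2) :=
      act_theta n a hn0 m1 m2 σ t
    rw [h, E.symm_apply_apply, E.symm_apply_apply]
    exact ⟨fun _ _ => rfl, rfl⟩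

end Stmt14
end

section
/- Let n ≥ 2 and 1 ≤ a ≤ n, and let G_a be the graph on vertex set {1,…,n} whose edges are all pairs {i,j} with i < j except the pairs {1,j} with j > a. Then for every N ≥ 1, the following identity holds in the polynomial ring ℤ[X_1,…,X_N]: the sum over all proper colorings κ : {1,…,n} → {1,…,N} of G_a (functions with κ(i) ≠ κ(j) for every edge {i,j}) of the monomial ∏_{i=1}^{n} X_{κ(i)} equals (n−a)·(n−2)!·e_{n−1}·e_1 + n·(a−1)·(n−2)!·e_n, where e_k denotes the k-th elementary symmetric polynomial in X_1,…,X_N. -/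
/-!
STATEMENT 15: Let G_a be the graph on {1,…,n} whose edges are all pairs {i,j},
i < j, except the pairs {1,j} with j > a (the incomparability graph of P_h for
h = (a,n,…,n)).  Then in ℤ[X_1,…,X_N], the sum over proper colorings
κ : {1,…,n} → {1,…,N} of ∏ X_{κ(i)} (the chromatic symmetric function in N
variables) equals (n-a)(n-2)!·e_{n-1}e_1 + n(a-1)(n-2)!·e_n.

Conventions: vertices and colors are 0-indexed; vertex `0` is the vertex "1",
and the removed edges {1,j}, j > a, are the pairs {0, j'} with (j':ℕ)+1 > a.
`MvPolynomial.esymm` gives the elementary symmetric polynomials (which vanish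
when the degree exceeds the number of variables).
-/

open MvPolynomial

namespace Stmt15

/-- Adjacency in G_a: all pairs of distinct vertices except {1,j} with j > a
(1-based), i.e. except {0,j} with a ≤ j (0-based). -/
def adj (n a : ℕ) (i j : Fin n) : Prop :=
  i ≠ j ∧ ¬((i : ℕ) = 0 ∧ a ≤ (j : ℕ)) ∧ ¬((j : ℕ) = 0 ∧ a ≤ (i : ℕ))

instance (n a : ℕ) (i j : Fin n) : Decidable (adj n a i j) := by
  unfold adj; infer_instance

/-- Sum over injective words is `m! e_m`. -/
theorem sum_inj (m N : ℕ) :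
    ∑ f ∈ Finset.univ.filter (fun f : Fin m → Fin N => Function.Injective f),
      ∏ i, (X (f i) : MvPolynomial (Fin N) ℤ)
    = (m.factorial : MvPolynomial (Fin N) ℤ) * esymm (Fin N) ℤ m := by
  classical
  have hmap : ∀ f ∈ Finset.univ.filter (fun f : Fin m → Fin N => Function.Injective f),
      Finset.univ.image f ∈ Finset.powersetCard m (Finset.univ : Finset (Fin N)) := by
    intro f hf
    simp only [Finset.mem_filter, Finset.mem_univ, true_and] at hf
    simp [Finset.mem_powersetCard, Finset.card_image_of_injective _ hf]
  rw [← Finset.sum_fiberwise_of_maps_to hmap, esymm, Finset.mul_sum]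
  refine Finset.sum_congr rfl fun s hs => ?_
  have hsc : s.card = m := (Finset.mem_powersetCard.1 hs).2
  have h1 : ∀ f ∈ (Finset.univ.filter (fun f : Fin m → Fin N => Function.Injective f)).filter
      (fun f => Finset.univ.image f = s),
      ∏ i, (X (f i) : MvPolynomial (Fin N) ℤ) = ∏ i ∈ s, X i := by
    intro f hf
    simp only [Finset.mem_filter, Finset.mem_univ, true_and] at hf
    rw [← hf.2, Finset.prod_image (fun x _ y _ h => hf.1 h)]
  rw [Finset.sum_congr rfl h1, Finset.sum_const, nsmul_eq_mul]
  congr 2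
  have e0 : Fin m ≃ s := (Fintype.equivFinOfCardEq (by simpa using hsc)).symm
  have hc : Fintype.card (Fin m ≃ s) = m.factorial := by
    rw [Fintype.card_equiv e0, Fintype.card_fin]
  rw [← hc, ← Finset.card_univ]
  symm
  refine Finset.card_bij (fun (e : Fin m ≃ s) _ => fun k => (e k : Fin N)) ?_ ?_ ?_
  · intro e _
    simp only [Finset.mem_filter, Finset.mem_univ, true_and]
    refine ⟨fun x y h => e.injective (Subtype.ext h), ?_⟩
    ext x
    simp only [Finset.mem_image, Finset.mem_univ, true_and]
    constructor
    · rintro ⟨k, rfl⟩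
      exact (e k).2
    · intro hx
      exact ⟨e.symm ⟨x, hx⟩, by simp⟩
  · intro e _ e' _ h
    ext k
    exact congrArg Fin.val (congrFun h k)
  · intro f hf
    simp only [Finset.mem_filter, Finset.mem_univ, true_and] at hf
    have hm : ∀ k, f k ∈ s := fun k => by
      rw [← hf.2]; exact Finset.mem_image_of_mem _ (Finset.mem_univ k)
    refine ⟨Equiv.ofBijective (fun k => (⟨f k, hm k⟩ : s)) ⟨?_, ?_⟩, Finset.mem_univ _, ?_⟩
    · intro x y h
      exact hf.1 (congrArg Subtype.val h)
    · rintro ⟨x, hx⟩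
      rw [← hf.2] at hx
      obtain ⟨k, _, hk⟩ := Finset.mem_image.1 hx
      exact ⟨k, Subtype.ext hk⟩
    · rfl

/-- Sum over injective words with the letter at position `j` doubled. -/
noncomputable def dsum (m N : ℕ) (j : Fin m) : MvPolynomial (Fin N) ℤ :=
  ∑ f ∈ Finset.univ.filter (fun f : Fin m → Fin N => Function.Injective f),
    X (f j) * ∏ i, X (f i)

theorem dsum_eq (m N : ℕ) (j k : Fin m) : dsum m N j = dsum m N k := by
  unfold dsum
  refine Finset.sum_equiv ((Equiv.swap j k).arrowCongr (Equiv.refl _)) ?_ ?_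
  · intro f
    simp [Equiv.arrowCongr]
  · intro f _
    have := Equiv.prod_comp (Equiv.swap j k) (fun i => (X (f i) : MvPolynomial (Fin N) ℤ))
    simp [Equiv.arrowCongr, this]

theorem proper_iff (m a N : ℕ) (c : Fin N) (f : Fin m → Fin N) :
    (∀ i j : Fin (m+1), adj (m+1) a i j →
      (Fin.cons c f : Fin (m+1) → Fin N) i ≠ (Fin.cons c f : Fin (m+1) → Fin N) j) ↔
    Function.Injective f ∧ ∀ j : Fin m, (j : ℕ) + 1 < a → c ≠ f j := by
  constructor
  · intro h
    constructor
    · intro x y hxy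
      by_contra hne
      refine h x.succ y.succ ⟨by simpa using hne, by simp, by simp⟩ (by simpa using hxy)
    · intro j hj
      have := h 0 j.succ ⟨(Fin.succ_ne_zero j).symm, by simp; omega, by simp⟩
      simpa using this
  · rintro ⟨hf, hc⟩ i j ⟨h1, h2, h3⟩
    induction i using Fin.cases with
    | zero =>
      induction j using Fin.cases with
      | zero => exact absurd rfl h1
      | succ j =>
        simp at h2
        simpa using hc j h2
    | succ i =>
      induction j using Fin.cases with
      | zero =>
        simp at h3
        simpa using (hc i h3).symm
      | succ j =>
        simp only [Fin.cons_succ]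
        exact fun h => h1 (congrArg Fin.succ (hf h))

theorem inner_sum (m a N : ℕ) (f : Fin m → Fin N) (hf : Function.Injective f) :
    ∑ c ∈ Finset.univ.filter (fun c : Fin N => ∀ j : Fin m, (j : ℕ) + 1 < a → c ≠ f j),
      (X c : MvPolynomial (Fin N) ℤ)
    = ∑ c, X c - ∑ j ∈ Finset.univ.filter (fun j : Fin m => (j : ℕ) + 1 < a), X (f j) := by
  classical
  rw [eq_sub_iff_add_eq, ← Finset.sum_image (f := fun c => (X c : MvPolynomial (Fin N) ℤ))
    (fun x _ y _ h => hf h), ← Finset.sum_filter_add_sum_filter_not Finset.univ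
    (fun c : Fin N => ∀ j : Fin m, (j : ℕ) + 1 < a → c ≠ f j)]
  congr 1
  refine Finset.sum_congr ?_ fun _ _ => rfl
  ext c
  simp [eq_comm]

theorem main_sum (m a N : ℕ) (ha : 1 ≤ a) (han : a ≤ m + 1) (k : Fin m) :
    ∑ κ ∈ Finset.univ.filter
        (fun κ : Fin (m+1) → Fin N => ∀ i j : Fin (m+1), adj (m+1) a i j → κ i ≠ κ j),
      ∏ i : Fin (m+1), (X (κ i) : MvPolynomial (Fin N) ℤ)
    = (m.factorial : MvPolynomial (Fin N) ℤ) * esymm (Fin N) ℤ m * esymm (Fin N) ℤ 1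
      - ((a - 1 : ℕ) : MvPolynomial (Fin N) ℤ) * dsum m N k := by
  classical
  have hcard : (Finset.univ.filter (fun j : Fin m => (j : ℕ) + 1 < a)).card = a - 1 := by
    have h : (Finset.univ.filter (fun j : Fin m => (j : ℕ) + 1 < a))
        = Finset.univ.filter (fun j : Fin m => (j : ℕ) < a - 1) := by
      ext j; simp; omega
    rw [h, Fin.card_filter_val_lt]
    omega
  have hD : ((a - 1 : ℕ) : MvPolynomial (Fin N) ℤ) * dsum m N k =
      ∑ j ∈ Finset.univ.filter (fun j : Fin m => (j : ℕ) + 1 < a), dsum m N j := by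
    rw [Finset.sum_congr rfl (fun j _ => dsum_eq m N j k), Finset.sum_const, hcard, nsmul_eq_mul]
  rw [hD, ← sum_inj, esymm_one]
  unfold dsum
  rw [Finset.sum_comm, Finset.sum_mul, ← Finset.sum_sub_distrib, Finset.sum_filter,
    ← (Fin.consEquiv (fun _ : Fin (m+1) => Fin N)).sum_comp, Fintype.sum_prod_type_right,
    Finset.sum_filter]
  refine Finset.sum_congr rfl fun f _ => ?_
  have h0 : ∀ c : Fin N, (Fin.consEquiv (fun _ : Fin (m+1) => Fin N)) (c, f)
      = (Fin.cons c f : Fin (m+1) → Fin N) := fun _ => rfl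
  simp only [h0, proper_iff, Fin.prod_univ_succ, Fin.cons_zero, Fin.cons_succ]
  by_cases hf : Function.Injective f
  · simp only [hf, true_and, if_true]
    rw [← Finset.sum_filter, ← Finset.sum_mul, inner_sum m a N f hf, ← Finset.sum_mul]
    ring
  · simp [hf]

theorem stmt15 (n a N : ℕ) (hn : 2 ≤ n) (ha : 1 ≤ a) (han : a ≤ n) (hN : 1 ≤ N) :
    ∑ κ ∈ Finset.univ.filter
        (fun κ : Fin n → Fin N => ∀ i j : Fin n, adj n a i j → κ i ≠ κ j),
      ∏ i : Fin n, (X (κ i) : MvPolynomial (Fin N) ℤ)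
    = (((n - a) * Nat.factorial (n - 2) : ℕ) : MvPolynomial (Fin N) ℤ) *
        (esymm (Fin N) ℤ (n - 1) * esymm (Fin N) ℤ 1) +
      ((n * (a - 1) * Nat.factorial (n - 2) : ℕ) : MvPolynomial (Fin N) ℤ) *
        esymm (Fin N) ℤ n := by
  obtain ⟨m, rfl⟩ : ∃ m, n = m + 2 := ⟨n - 2, by omega⟩
  have hS := main_sum (m+1) a N ha han 0
  have hT := main_sum (m+1) (m+2) N (by omega) le_rfl 0
  have hI : Finset.univ.filter (fun κ : Fin (m+2) → Fin N =>
      ∀ i j : Fin (m+2), adj (m+2) (m+2) i j → κ i ≠ κ j)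
      = Finset.univ.filter (fun κ : Fin (m+2) → Fin N => Function.Injective κ) := by
    refine Finset.filter_congr fun κ _ => ⟨fun h x y hxy => ?_, fun h i j hij => h.ne hij.1⟩
    by_contra hne
    exact h x y ⟨hne, by omega, by omega⟩ hxy
  rw [hI, sum_inj] at hT
  rw [hS]
  obtain ⟨b, rfl⟩ : ∃ b, a = b + 1 := ⟨a - 1, by omega⟩
  obtain ⟨d, hd⟩ : ∃ d, m + 1 = b + d := ⟨m + 1 - b, by omega⟩
  have e1 : m + 2 - (b + 1) = d := by omega
  have e2 : m + 2 - 1 = m + 1 := by omega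
  have hd' : (m : MvPolynomial (Fin N) ℤ) + 1 = b + d := by exact_mod_cast hd
  have hm : (m : MvPolynomial (Fin N) ℤ) + 1 ≠ 0 := by exact_mod_cast Nat.succ_ne_zero m
  simp only [e1, e2, Nat.add_sub_cancel, Nat.factorial_succ] at hT ⊢
  push_cast at hT ⊢
  apply mul_left_cancel₀ hm
  have hdd : (d : MvPolynomial (Fin N) ℤ) = m + 1 - b := by rw [hd']; ring
  rw [hdd]
  linear_combination -(b : MvPolynomial (Fin N) ℤ) * hT

end Stmt15
end

section
/- Let n ≥ 1 and 1 ≤ a ≤ n, and let h = (a,n,…,n). Then the following identity holds in the polynomial ring ℤ[q]: the sum over all P_h-tableaux σ of column shape (1^n) of q^{inv_P(σ)} equals [a]_q · ∏_{j=1}^{n−1} [j]_q, where [k]_q = 1 + q + ⋯ + q^{k−1}. -/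
/-!
STATEMENT 16: For h = (a,n,…,n), the inversion generating function of the
P_h-tableaux of column shape (1^n) is [a]_q · [n-1]_q! :
∑_{σ} q^{inv_P(σ)} = [a]_q · ∏_{j=1}^{n-1} [j]_q in ℤ[q].

Conventions: entries and positions are 0-indexed; the 1-based value of
`j : Fin n` is `(j:ℕ)+1`; h = (a,n,…,n) takes 1-based values. A column tableau
is a permutation σ (σ r = entry of the r-th row from the bottom) with
σ(r+1) <_P σ(r) never holding, where i <_P j iff h(i) < j. [k]_q is
∑_{i<k} q^i.
-/

namespace Stmt16

/-- The Hessenberg function h = (a,n,…,n) in 0-indexed form. -/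
def hFun (n a : ℕ) : Fin n → ℕ := fun j => if (j : ℕ) = 0 then a else n

/-- The P_h-tableau condition for a column tableau. -/
def isPTab (n : ℕ) (h : Fin n → ℕ) (σ : Equiv.Perm (Fin n)) : Prop :=
  ∀ r s : Fin n, (s : ℕ) = (r : ℕ) + 1 → ¬ (h (σ s) < (σ r : ℕ) + 1)

instance (n : ℕ) (h : Fin n → ℕ) (σ : Equiv.Perm (Fin n)) :
    Decidable (isPTab n h σ) := by
  unfold isPTab; infer_instance

/-- The number of P_h-inversions of a column tableau σ. -/
def invP (n : ℕ) (h : Fin n → ℕ) (σ : Equiv.Perm (Fin n)) : ℕ :=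
  (Finset.univ.filter (fun p : Fin n × Fin n =>
    p.1 < p.2 ∧ σ p.2 < σ p.1 ∧ (σ p.1 : ℕ) + 1 ≤ h (σ p.2))).card

/-- Insert the value `0` at position `p` in `τ`. -/
def ins {m : ℕ} (p : Fin (m+1)) (τ : Equiv.Perm (Fin m)) : Equiv.Perm (Fin (m+1)) :=
  ((finSuccEquiv' p).trans (Equiv.optionCongr τ)).trans (finSuccEquiv' 0).symm

lemma ins_self {m : ℕ} (p : Fin (m+1)) (τ : Equiv.Perm (Fin m)) : ins p τ p = 0 := by
  simp [ins]

lemma ins_succAbove {m : ℕ} (p : Fin (m+1)) (τ : Equiv.Perm (Fin m)) (i : Fin m) :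
    ins p τ (p.succAbove i) = (τ i).succ := by
  simp [ins]

lemma ins_inj {m : ℕ} : Function.Injective
    (fun x : Fin (m+1) × Equiv.Perm (Fin m) => ins x.1 x.2) := by
  rintro ⟨p, τ⟩ ⟨p', τ'⟩ h
  simp only at h
  have hp : p = p' := by
    apply (ins p τ).injective
    rw [ins_self, h, ins_self]
  subst hp
  have : τ = τ' := by
    ext i
    have h2 := ins_succAbove p τ i
    rw [h, ins_succAbove] at h2
    rw [Fin.succ_injective _ h2]
  rw [this]

lemma ins_bij {m : ℕ} : Function.Bijective
    (fun x : Fin (m+1) × Equiv.Perm (Fin m) => ins x.1 x.2) := by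
  rw [Fintype.bijective_iff_injective_and_card]
  refine ⟨ins_inj, ?_⟩
  simp [Fintype.card_perm, Nat.factorial_succ]

lemma geom_aux (m : ℕ) (P : Fin m → Prop) [DecidablePred P] :
    1 + ∑ j, (if P j then (Polynomial.X : Polynomial ℤ) ^
        (∑ i, if i ≤ j ∧ P i then 1 else 0 : ℕ) else 0)
      = ∑ i ∈ Finset.range ((∑ i, if P i then 1 else 0) + 1), Polynomial.X ^ i := by
  induction m with
  | zero => simp
  | succ m ih =>
    have := ih (fun i => P i.castSucc)
    have hlt : ∀ x : Fin m, ¬ (Fin.last m ≤ x.castSucc) := fun x => by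
      simp [Fin.le_def]
    simp only [Fin.sum_univ_castSucc, Fin.castSucc_le_castSucc_iff, hlt, Fin.le_last, true_and,
      false_and, if_false, add_zero]
    rw [← add_assoc, this]
    by_cases h : P (Fin.last m)
    · simp only [h, if_true]
      rw [Finset.sum_range_succ _ (_ + 1)]
    · simp [h]

lemma invP_ins {m a : ℕ} (p : Fin (m+1)) (τ : Equiv.Perm (Fin m)) :
    invP (m+1) (hFun (m+1) a) (ins p τ) =
      (∑ i : Fin m, if i.castSucc < p ∧ (τ i : ℕ) + 2 ≤ a then 1 else 0)
        + invP m (hFun m m) τ := by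
  unfold invP
  rw [Finset.card_filter, Finset.card_filter, Fintype.sum_prod_type, Fintype.sum_prod_type,
    Fin.sum_univ_succAbove _ p]
  have h0 : ∀ y : Fin m, (τ y : ℕ) + 1 ≤ m := fun y => (τ y).2
  simp only [Fin.sum_univ_succAbove _ p, ins_self, ins_succAbove, hFun,
    Fin.succAbove_lt_iff_castSucc_lt, Fin.succAbove_lt_succAbove_iff, Fin.succ_lt_succ_iff]
  simp [Finset.sum_add_distrib, h0, add_assoc]

lemma isPTab_zero {m a : ℕ} (τ : Equiv.Perm (Fin m)) :
    isPTab (m+1) (hFun (m+1) a) (ins 0 τ) := by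
  intro r s hs
  rcases Fin.eq_self_or_eq_succAbove 0 s with h | ⟨j, h⟩
  · subst h; simp at hs
  · rw [h, ins_succAbove]
    have := (ins 0 τ r).2
    simp [hFun]; omega

lemma isPTab_succ {m a : ℕ} (j : Fin m) (τ : Equiv.Perm (Fin m)) :
    isPTab (m+1) (hFun (m+1) a) (ins j.succ τ) ↔ (τ j : ℕ) + 2 ≤ a := by
  have hj : ins j.succ τ j.castSucc = (τ j).succ := by
    rw [← ins_succAbove j.succ τ j, Fin.succAbove_of_castSucc_lt _ _ (Fin.castSucc_lt_succ)]
  constructor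
  · intro h
    have := h j.castSucc j.succ (by simp)
    rw [hj, ins_self] at this
    simp [hFun] at this; omega
  · intro h r s hs
    rcases Fin.eq_self_or_eq_succAbove j.succ s with h' | ⟨k, h'⟩
    · have hr : r = j.castSucc := by
        ext; subst h'; simp at hs ⊢; omega
      rw [hr, h', hj, ins_self]
      simp [hFun]; omega
    · rw [h', ins_succAbove]
      have := (ins j.succ τ r).2
      simp [hFun]; omega

lemma count_aux {m a : ℕ} (ha : 1 ≤ a) (han : a ≤ m + 1) (τ : Equiv.Perm (Fin m)) :
    (∑ i : Fin m, if (τ i : ℕ) + 2 ≤ a then 1 else 0) + 1 = a := by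
  rw [Equiv.sum_comp τ (fun i : Fin m => if (i : ℕ) + 2 ≤ a then 1 else 0),
    Fin.sum_univ_eq_sum_range (fun i => if i + 2 ≤ a then 1 else 0) m, ← Finset.card_filter]
  have : (Finset.range m).filter (fun i => i + 2 ≤ a) = Finset.range (a - 1) := by
    ext i; simp; omega
  rw [this, Finset.card_range]; omega

lemma step (m a : ℕ) (ha : 1 ≤ a) (han : a ≤ m + 1) :
    ∑ σ ∈ Finset.univ.filter
        (fun σ : Equiv.Perm (Fin (m+1)) => isPTab (m+1) (hFun (m+1) a) σ),
        (Polynomial.X : Polynomial ℤ) ^ invP (m+1) (hFun (m+1) a) σ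
    = (∑ i ∈ Finset.range a, (Polynomial.X : Polynomial ℤ) ^ i) *
        ∑ τ : Equiv.Perm (Fin m), (Polynomial.X : Polynomial ℤ) ^ invP m (hFun m m) τ := by
  rw [Finset.sum_filter, ← Function.Bijective.sum_comp ins_bij, Fintype.sum_prod_type,
    Finset.sum_comm, Finset.mul_sum]
  refine Finset.sum_congr rfl fun τ _ => ?_
  have := geom_aux m (fun i => (τ i : ℕ) + 2 ≤ a)
  rw [count_aux ha han τ] at this
  rw [← this, Fin.sum_univ_succ, add_mul, Finset.sum_mul]
  simp only [isPTab_zero, isPTab_succ, invP_ins, if_true]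
  congr 1
  · simp
  · refine Finset.sum_congr rfl fun j _ => ?_
    simp only [Fin.castSucc_lt_succ_iff]
    split_ifs
    · rw [pow_add]
    · simp

lemma full (m : ℕ) :
    ∑ τ : Equiv.Perm (Fin m), (Polynomial.X : Polynomial ℤ) ^ invP m (hFun m m) τ
      = ∏ j ∈ Finset.range m,
          ∑ i ∈ Finset.range (j + 1), (Polynomial.X : Polynomial ℤ) ^ i := by
  induction m with
  | zero => simp [invP]
  | succ m ih =>
    rw [Finset.prod_range_succ, ← ih, mul_comm, ← step m (m+1) (by omega) le_rfl,
      Finset.filter_true_of_mem]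
    intro σ _ r s _
    have := (σ r).2
    simp [hFun]; omega

theorem stmt16 (n a : ℕ) (hn : 1 ≤ n) (ha : 1 ≤ a) (han : a ≤ n) :
    ∑ σ ∈ Finset.univ.filter (fun σ : Equiv.Perm (Fin n) => isPTab n (hFun n a) σ),
        (Polynomial.X : Polynomial ℤ) ^ invP n (hFun n a) σ
    = (∑ i ∈ Finset.range a, (Polynomial.X : Polynomial ℤ) ^ i) *
        ∏ j ∈ Finset.range (n - 1),
          ∑ i ∈ Finset.range (j + 1), (Polynomial.X : Polynomial ℤ) ^ i := by
  obtain ⟨m, rfl⟩ : ∃ m, n = m + 1 := ⟨n - 1, by omega⟩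
  rw [step m a ha han, full, Nat.add_sub_cancel]

end Stmt16
end

section
/- Let n ≥ 2 and 1 ≤ a ≤ n, and let h = (a,n,…,n). Then the following identity holds in the polynomial ring ℤ[q]: the sum over all P_h-tableaux T of shape (2,1^{n−2}) of q^{inv_P(T)} equals q^{a−1} · [n−a]_q · ∏_{j=1}^{n−2} [j]_q, where [k]_q = 1 + q + ⋯ + q^{k−1} (so both sides are 0 when a = n). -/
/-!
STATEMENT 17: For h = (a,n,…,n) with n ≥ 2, the inversion generating function
of the P_h-tableaux of shape (2,1^{n-2}) is q^{a-1}·[n-a]_q·[n-2]_q! in ℤ[q]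
(both sides are 0 when a = n).

Conventions/encodings (following the context): a P_h-tableau of shape
(2,1^{n-2}) is encoded by a pair (b, τ) with bottom row (1,b), a+1 ≤ b ≤ n, and
τ the list of column entries from bottom to top (injective, avoiding the
entries 1 and b); all such pairs are valid, and
inv_P(b,τ) = (b-2) + #{r < s : τ(s) < τ(r)}.  Here b is encoded 0-indexed as
`p.1 : Fin n` with 1-based value (p.1:ℕ)+1 (so a+1 ≤ b ⇔ a ≤ (p.1:ℕ), b ≤ n is
automatic, and b-2 = (p.1:ℕ)-1), and the entries of τ are 0-indexed elements of
Fin n (the entry "1" is 0, the entry "b" is p.1).  [k]_q = ∑_{i<k} q^i.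
-/

namespace Stmt17

/-- The number of inversions of the column list τ. -/
def invTau (n : ℕ) (τ : Fin (n - 2) → Fin n) : ℕ :=
  (Finset.univ.filter (fun q : Fin (n - 2) × Fin (n - 2) =>
    q.1 < q.2 ∧ τ q.2 < τ q.1)).card

/-- The encoded hook-shaped P_h-tableaux: pairs (b,τ) as above. -/
def isHookPTab (n a : ℕ) (p : Fin n × (Fin (n - 2) → Fin n)) : Prop :=
  a ≤ (p.1 : ℕ) ∧ Function.Injective p.2 ∧
    ∀ r : Fin (n - 2), (p.2 r : ℕ) ≠ 0 ∧ p.2 r ≠ p.1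

instance (n a : ℕ) (p : Fin n × (Fin (n - 2) → Fin n)) :
    Decidable (isHookPTab n a p) := by
  unfold isHookPTab; infer_instance

theorem sum_rank {α : Type*} [LinearOrder α] (S : Finset α) :
    ∑ x ∈ S, (Polynomial.X : Polynomial ℤ) ^ (S.filter (fun y => y < x)).card
      = ∑ i ∈ Finset.range S.card, (Polynomial.X : Polynomial ℤ) ^ i := by
  induction S using Finset.induction_on_max with
  | empty => simp
  | insert m S hm ih =>
    have hmS : m ∉ S := fun h => lt_irrefl _ (hm m h)
    rw [Finset.sum_insert hmS, Finset.card_insert_of_notMem hmS, Finset.sum_range_succ, ← ih,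
      add_comm]
    congr 1
    · refine Finset.sum_congr rfl fun x hx => ?_
      rw [Finset.filter_insert, if_neg (not_lt.mpr (hm x hx).le)]
    · rw [Finset.filter_insert, if_neg (lt_irrefl m), Finset.filter_true_of_mem hm]

def invG {α : Type*} [LinearOrder α] (m : ℕ) (τ : Fin m → α) : ℕ :=
  (Finset.univ.filter (fun q : Fin m × Fin m => q.1 < q.2 ∧ τ q.2 < τ q.1)).card

theorem invG_cons {α : Type*} [LinearOrder α] (m : ℕ) (x : α) (τ : Fin m → α) :
    invG (m + 1) (Fin.cons x τ : Fin (m + 1) → α)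
      = (Finset.univ.filter (fun s : Fin m => τ s < x)).card + invG m τ := by
  unfold invG
  simp only [Finset.card_filter, Fintype.sum_prod_type, Fin.sum_univ_succ, Fin.cons_zero,
    Fin.cons_succ, Fin.succ_lt_succ_iff, Fin.succ_pos, true_and, Fin.not_lt_zero, false_and,
    lt_irrefl, if_false, zero_add]

theorem image_count {α : Type*} [LinearOrder α] (m : ℕ) (S : Finset α) (hS : S.card = m + 1)
    (x : α) (hx : x ∈ S) (τ : Fin m → α) (hi : Function.Injective τ)
    (hτ : ∀ r, τ r ∈ S.erase x) :
    (Finset.univ.filter (fun s : Fin m => τ s < x)).card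
      = (S.filter (fun y => y < x)).card := by
  have himg : Finset.univ.image τ = S.erase x := by
    apply Finset.eq_of_subset_of_card_le
    · intro y hy
      obtain ⟨r, -, rfl⟩ := Finset.mem_image.mp hy
      exact hτ r
    · rw [Finset.card_image_of_injective _ hi, Finset.card_erase_of_mem hx, hS]
      simp
  have h2 : S.filter (fun y => y < x) = (S.erase x).filter (fun y => y < x) := by
    ext y
    simp only [Finset.mem_filter, Finset.mem_erase]
    constructor
    · rintro ⟨h, h'⟩
      exact ⟨⟨h'.ne, h⟩, h'⟩
    · rintro ⟨⟨_, h⟩, h'⟩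
      exact ⟨h, h'⟩
  rw [h2, ← himg, Finset.filter_image, Finset.card_image_of_injective _ hi]

open Classical in
theorem sum_inv {α : Type*} [LinearOrder α] [Fintype α] (m : ℕ) :
    ∀ S : Finset α, S.card = m →
    ∑ τ : Fin m → α, (if Function.Injective τ ∧ ∀ r, τ r ∈ S then
        (Polynomial.X : Polynomial ℤ) ^ invG m τ else 0)
      = ∏ j ∈ Finset.range m, ∑ i ∈ Finset.range (j + 1), (Polynomial.X : Polynomial ℤ) ^ i := by
  induction m with
  | zero =>
    intro S _
    simp [invG, Function.injective_of_subsingleton]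
  | succ m ih =>
    intro S hS
    have hr := sum_rank S
    rw [hS] at hr
    rw [← (Fin.consEquiv (fun _ : Fin (m + 1) => α)).sum_comp, Fintype.sum_prod_type,
      Finset.prod_range_succ, ← hr, Finset.mul_sum,
      ← Finset.sum_subset (Finset.subset_univ S)]
    · refine Finset.sum_congr rfl fun x hx => ?_
      rw [← ih (S.erase x) (by rw [Finset.card_erase_of_mem hx, hS]; rfl), Finset.sum_mul]
      refine Finset.sum_congr rfl fun τ _ => ?_
      have hiff : (Function.Injective (Fin.cons x τ : Fin (m + 1) → α) ∧
          ∀ r, (Fin.cons x τ : Fin (m + 1) → α) r ∈ S) ↔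
          (Function.Injective τ ∧ ∀ r, τ r ∈ S.erase x) := by
        rw [Fin.cons_injective_iff, Fin.forall_fin_succ]
        simp only [Fin.cons_zero, Fin.cons_succ, Finset.mem_erase, Set.mem_range, not_exists]
        constructor
        · rintro ⟨⟨h1, h2⟩, _, h3⟩
          exact ⟨h2, fun r => ⟨h1 r, h3 r⟩⟩
        · rintro ⟨h2, h3⟩
          exact ⟨⟨fun r => (h3 r).1, h2⟩, hx, fun r => (h3 r).2⟩
      change (if (Function.Injective (Fin.cons x τ : Fin (m + 1) → α) ∧
          ∀ r, (Fin.cons x τ : Fin (m + 1) → α) r ∈ S) then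
          (Polynomial.X : Polynomial ℤ) ^ invG (m + 1) (Fin.cons x τ : Fin (m + 1) → α)
          else 0) = _
      by_cases h : Function.Injective τ ∧ ∀ r, τ r ∈ S.erase x
      · rw [if_pos (hiff.mpr h), if_pos h, invG_cons, image_count m S hS x hx τ h.1 h.2, pow_add,
          mul_comm]
      · rw [if_neg (fun h' => h (hiff.mp h')), if_neg h, zero_mul]
    · intro x _ hx
      refine Finset.sum_eq_zero fun τ _ => if_neg ?_
      rintro ⟨_, h⟩
      exact hx (h 0)

theorem stmt17 (n a : ℕ) (hn : 2 ≤ n) (ha : 1 ≤ a) (han : a ≤ n) :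
    ∑ p ∈ Finset.univ.filter (fun p : Fin n × (Fin (n - 2) → Fin n) =>
        isHookPTab n a p),
        (Polynomial.X : Polynomial ℤ) ^ (((p.1 : ℕ) - 1) + invTau n p.2)
    = (Polynomial.X : Polynomial ℤ) ^ (a - 1) *
        (∑ i ∈ Finset.range (n - a), (Polynomial.X : Polynomial ℤ) ^ i) *
        ∏ j ∈ Finset.range (n - 2),
          ∑ i ∈ Finset.range (j + 1), (Polynomial.X : Polynomial ℤ) ^ i := by
  classical
  rw [Finset.sum_filter, Fintype.sum_prod_type]
  have key : ∀ b : Fin n, (∑ τ : Fin (n - 2) → Fin n, if isHookPTab n a (b, τ) then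
      (Polynomial.X : Polynomial ℤ) ^ (((b : ℕ) - 1) + invTau n τ) else 0)
      = (if a ≤ (b : ℕ) then (Polynomial.X : Polynomial ℤ) ^ ((b : ℕ) - 1) else 0) *
        ∏ j ∈ Finset.range (n - 2),
          ∑ i ∈ Finset.range (j + 1), (Polynomial.X : Polynomial ℤ) ^ i := by
    intro b
    by_cases hb : a ≤ (b : ℕ)
    · have hne : b ≠ (⟨0, by omega⟩ : Fin n) := by
        intro h
        rw [h] at hb
        simp at hb
        omega
      have hcard : (((Finset.univ : Finset (Fin n)).erase ⟨0, by omega⟩).erase b).card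
          = n - 2 := by
        rw [Finset.card_erase_of_mem (by simpa using hne),
          Finset.card_erase_of_mem (Finset.mem_univ _), Finset.card_univ, Fintype.card_fin]
        omega
      rw [if_pos hb, ← sum_inv (n - 2) _ hcard, Finset.mul_sum]
      refine Finset.sum_congr rfl fun τ _ => ?_
      have hiff : isHookPTab n a (b, τ) ↔ (Function.Injective τ ∧
          ∀ r, τ r ∈ ((Finset.univ : Finset (Fin n)).erase ⟨0, by omega⟩).erase b) := by
        simp only [isHookPTab, hb, true_and, Finset.mem_erase, Finset.mem_univ, and_true, ne_eq,
          Fin.ext_iff]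
        simp only [and_comm]
      by_cases h : isHookPTab n a (b, τ)
      · rw [if_pos h, if_pos (hiff.mp h), pow_add]
        rfl
      · rw [if_neg h, if_neg (fun h' => h (hiff.mpr h')), mul_zero]
    · rw [if_neg hb, zero_mul]
      exact Finset.sum_eq_zero fun τ _ => if_neg fun h => hb h.1
  rw [Finset.sum_congr rfl fun b _ => key b, ← Finset.sum_mul]
  congr 1
  rw [Fin.sum_univ_eq_sum_range
    (fun b => if a ≤ b then (Polynomial.X : Polynomial ℤ) ^ (b - 1) else 0) n,
    ← Finset.sum_filter]
  have hI : (Finset.range n).filter (fun b => a ≤ b) = Finset.Ico a n := by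
    ext b
    simp [and_comm]
  rw [hI, Finset.sum_Ico_eq_sum_range, Finset.mul_sum]
  refine Finset.sum_congr rfl fun i _ => ?_
  rw [← pow_add]
  congr 1
  omega

end Stmt17
end
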